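/- Fix an integer N ≥ 3, positive integers M1, ..., MN, reals L > 0 and r > 0. Let H_1, ..., H_{N−1} be mutually independent standard complex Gaussian random matrices, H_i of size M_{i+1}×M_i, and for ρ > 1 let C_i(ρ) = log det(I + (ρ/M_i) H_i H_i†). Then the outage probability of the rate-splitting VBL ARQ scheme, P_out(ρ) = P( ∪_{i=1}^{N−2} { r·log ρ / C_i(ρ) + r·log ρ / C_{i+1}(ρ) > L } ), satisfies lim_{ρ→∞} log P_out(ρ) / log ρ = − min_{i=1,...,N−2} d_VBL^{(M_i, M_{i+1}, M_{i+2})}(r, L), where for positive integers a, b, c, d_VBL^{(a,b,c)}(r, L) = inf{ Σ_{j=1}^{min(a,b)} (2j−1+|a−b|)·α_j + Σ_{j=1}^{min(b,c)} (2j−1+|b−c|)·β_j : α_1 ≥ ... ≥ α_{min(a,b)} ≥ 0, β_1 ≥ ... ≥ β_{min(b,c)} ≥ 0, r/Σ_j max(1−α_j,0) + r/Σ_j max(1−β_j,0) > L }, with the convention r/0 = +∞. (Theorem 7: the DMDT of the VBL ARQ protocol for an N-node MIMO multihop network equals the minimum of the DMDTs of its three-node sub-networks, under the long-term static channel assumption.)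 -/

import Mathlib

open MeasureTheory ProbabilityTheory

/-- The capacity `log det (I + (ρ / M) H Hᴴ)` of a MIMO channel with matrix `H`. -/
noncomputable def cap {a b : ℕ} (M : ℕ) (ρ : ℝ) (H : Matrix (Fin a) (Fin b) ℂ) : ℝ :=
  Real.log ((1 + ((ρ / M : ℝ) : ℂ) • (H * H.conjTranspose)).det.re)

/-- The asymptotic DMDT `d_VBL^{(a,b,c)}(r, L)` of the VBL ARQ protocol for a three-node
`(a, b, c)` network (long-term static channel): the infimum of
`Σ_j (2j-1+|a-b|) α_j + Σ_j (2j-1+|b-c|) β_j` over nonnegative decreasingly-ordered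
`α ∈ ℝ^{min a b}`, `β ∈ ℝ^{min b c}` with `r/Σ_j(1-α_j)⁺ + r/Σ_j(1-β_j)⁺ > L`, with the
convention `r/0 = +∞` (implemented with `ℝ≥0∞`-valued division). -/
noncomputable def dVBL (a b c : ℕ) (r L : ℝ) : ℝ :=
  sInf {x : ℝ | ∃ (α : Fin (min a b) → ℝ) (β : Fin (min b c) → ℝ),
    (∀ j k, j ≤ k → α k ≤ α j) ∧ (∀ j, 0 ≤ α j) ∧
    (∀ j k, j ≤ k → β k ≤ β j) ∧ (∀ j, 0 ≤ β j) ∧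
    ENNReal.ofReal r / ENNReal.ofReal (∑ j, max (1 - α j) 0)
      + ENNReal.ofReal r / ENNReal.ofReal (∑ j, max (1 - β j) 0) > ENNReal.ofReal L ∧
    x = (∑ j, (2 * (j.val : ℝ) + 1 + |(a : ℝ) - (b : ℝ)|) * α j)
      + (∑ j, (2 * (j.val : ℝ) + 1 + |(b : ℝ) - (c : ℝ)|) * β j)}



section PartA
set_option linter.unusedSectionVars false
set_option linter.unusedVariables false
open scoped ComplexOrder Matrix

/-- the Gram-type determinant `det (1 + ρ H Hᴴ)` -/
noncomputable def gdet {ι κ : Type*} [Fintype ι] [DecidableEq ι] [Fintype κ]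
    (ρ : ℝ) (H : Matrix ι κ ℂ) : ℝ :=
  (1 + (ρ : ℂ) • (H * Hᴴ)).det.re

variable {ι κ l : Type*} [Fintype ι] [DecidableEq ι] [Fintype κ] [DecidableEq κ]
  [Fintype l] [DecidableEq l]

lemma one_le_det_one_add {A : Matrix ι ι ℂ} (hA : A.PosSemidef) : 1 ≤ (1 + A).det.re := by
  have h := hA.1.spectral_theorem
  have hdet : (1 + A).det = ∏ i, ((1 + hA.1.eigenvalues i : ℝ) : ℂ) := by
    have : 1 + A = Unitary.conjStarAlgAut ℂ _ hA.1.eigenvectorUnitary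
        (1 + Matrix.diagonal (RCLike.ofReal ∘ hA.1.eigenvalues)) := by
      rw [map_add, map_one, ← h]
    rw [this, Unitary.conjStarAlgAut_apply, Matrix.det_mul, Matrix.det_mul, mul_right_comm,
      ← Matrix.det_mul]
    simp only [Unitary.mul_star_self_of_mem, SetLike.coe_mem, Matrix.det_one, one_mul]
    rw [← Matrix.diagonal_one, Matrix.diagonal_add, Matrix.det_diagonal]
    simp
  rw [hdet, ← Complex.ofReal_prod, Complex.ofReal_re]
  calc (1:ℝ) = ∏ i : ι, (1:ℝ) := by simp
    _ ≤ _ := Finset.prod_le_prod (by simp) (fun i _ => by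
      have := hA.eigenvalues_nonneg i
      linarith)

lemma det_re_mono {A E : Matrix ι ι ℂ} (hA : A.PosDef) (hE : E.PosSemidef) :
    A.det.re ≤ (A + E).det.re := by
  obtain ⟨F, rfl⟩ := by
    open scoped MatrixOrder in
    exact CStarAlgebra.nonneg_iff_eq_star_mul_self.mp hE.nonneg
  have hu : IsUnit A.det := (Matrix.isUnit_iff_isUnit_det A).1 hA.isUnit
  have h1 : A + star F * F = A * (1 + A⁻¹ * (Fᴴ * F)) := by
    rw [Matrix.mul_add, Matrix.mul_one, ← Matrix.mul_assoc, Matrix.mul_nonsing_inv _ hu,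
      Matrix.one_mul]; rfl
  have h2 : (1 + A⁻¹ * (Fᴴ * F)).det = (1 + F * A⁻¹ * Fᴴ).det := by
    rw [← Matrix.mul_assoc, Matrix.det_one_add_mul_comm, Matrix.mul_assoc]
  have hP : (F * A⁻¹ * Fᴴ).PosSemidef := hA.inv.posSemidef.mul_mul_conjTranspose_same F
  have h3 := one_le_det_one_add hP
  have hpos := hA.det_pos
  rw [h1, Matrix.det_mul, h2, Complex.mul_re]
  rw [Complex.lt_def] at hpos
  have him : A.det.im = 0 := hpos.2.symm
  have hre : 0 < A.det.re := hpos.1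
  rw [him, zero_mul, sub_zero]
  nlinarith

lemma posSemidef_smul_real {A : Matrix ι ι ℂ} (hA : A.PosSemidef) {c : ℝ} (hc : 0 ≤ c) :
    ((c : ℂ) • A).PosSemidef :=
  hA.smul (by exact_mod_cast hc)

lemma one_le_gdet {ρ : ℝ} (hρ : 0 ≤ ρ) (H : Matrix ι κ ℂ) : 1 ≤ gdet ρ H :=
  one_le_det_one_add (posSemidef_smul_real (Matrix.posSemidef_self_mul_conjTranspose H) hρ)

lemma gdet_conjTranspose (ρ : ℝ) (H : Matrix ι κ ℂ) : gdet ρ Hᴴ = gdet ρ H := by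
  unfold gdet
  rw [Matrix.conjTranspose_conjTranspose, ← Matrix.smul_mul, Matrix.det_one_add_mul_comm,
    Matrix.mul_smul]

lemma posSemidef_bound {q : ℝ} (U : Matrix κ l ℂ) (hU : ∀ i j, ‖U i j‖ ≤ 1)
    (hq : (Fintype.card κ : ℝ) * Fintype.card l ≤ q) :
    ((q : ℂ) • (1 : Matrix κ κ ℂ) - U * Uᴴ).PosSemidef := by
  refine Matrix.PosSemidef.of_dotProduct_mulVec_nonneg ?_ ?_
  · refine Matrix.IsHermitian.sub ?_ (Matrix.isHermitian_mul_conjTranspose_self U)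
    unfold Matrix.IsHermitian
    simp
  · intro x
    have e1 : star x ⬝ᵥ ((U * Uᴴ) *ᵥ x) = star (Uᴴ *ᵥ x) ⬝ᵥ (Uᴴ *ᵥ x) := by
      rw [Matrix.star_mulVec, Matrix.conjTranspose_conjTranspose, ← Matrix.dotProduct_mulVec,
        Matrix.mulVec_mulVec]
    have e2 : ∀ y : κ → ℂ, star y ⬝ᵥ y = ((∑ i, ‖y i‖ ^ 2 : ℝ) : ℂ) := by
      intro y
      simp only [dotProduct, Pi.star_apply, RCLike.star_def, Complex.ofReal_sum]
      refine Finset.sum_congr rfl fun i _ => ?_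
      rw [mul_comm, Complex.mul_conj, Complex.normSq_eq_norm_sq]
    have e3 : ∀ y : l → ℂ, star y ⬝ᵥ y = ((∑ i, ‖y i‖ ^ 2 : ℝ) : ℂ) := by
      intro y
      simp only [dotProduct, Pi.star_apply, RCLike.star_def, Complex.ofReal_sum]
      refine Finset.sum_congr rfl fun i _ => ?_
      rw [mul_comm, Complex.mul_conj, Complex.normSq_eq_norm_sq]
    rw [Matrix.sub_mulVec, dotProduct_sub, e1, Matrix.smul_mulVec, Matrix.one_mulVec,
      dotProduct_smul, e2, e3, smul_eq_mul, ← Complex.ofReal_mul, ← Complex.ofReal_sub]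
    rw [Complex.zero_le_real, sub_nonneg]
    have hb : ∀ j, ‖(Uᴴ *ᵥ x) j‖ ^ 2 ≤ Fintype.card κ * ∑ i, ‖x i‖ ^ 2 := by
      intro j
      have : ‖(Uᴴ *ᵥ x) j‖ ≤ ∑ i, ‖x i‖ := by
        simp only [Matrix.mulVec, dotProduct]
        refine (norm_sum_le _ _).trans (Finset.sum_le_sum fun i _ => ?_)
        rw [norm_mul, Matrix.conjTranspose_apply, norm_star]
        nlinarith [hU i j, norm_nonneg (x i), norm_nonneg (U i j)]
      calc _ ≤ (∑ i, ‖x i‖) ^ 2 := by gcongr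
        _ ≤ _ := by
          have := sq_sum_le_card_mul_sum_sq (s := Finset.univ) (f := fun i => ‖x i‖)
          simpa using this
    calc _ ≤ ∑ j : l, Fintype.card κ * ∑ i, ‖x i‖ ^ 2 := Finset.sum_le_sum fun j _ => hb j
      _ = (Fintype.card κ * Fintype.card l) * ∑ i, ‖x i‖ ^ 2 := by
        simp; ring
      _ ≤ _ := by
        gcongr

lemma gdet_mul_right {ρ q : ℝ} (hρ : 0 ≤ ρ) (H : Matrix ι κ ℂ) (U : Matrix κ l ℂ)
    (hU : ∀ i j, ‖U i j‖ ≤ 1) (hq : (Fintype.card κ : ℝ) * Fintype.card l ≤ q) :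
    gdet ρ (H * U) ≤ gdet (ρ * q) H := by
  have h1 := (posSemidef_bound U hU hq).mul_mul_conjTranspose_same H
  have h2 := posSemidef_smul_real h1 hρ
  have h3 : (1 + (ρ : ℂ) • ((H * U) * (H * U)ᴴ)).PosDef :=
    Matrix.PosDef.one.add_posSemidef
      (posSemidef_smul_real (Matrix.posSemidef_self_mul_conjTranspose _) hρ)
  have h4 := det_re_mono h3 h2
  unfold gdet
  refine h4.trans (le_of_eq ?_)
  congr 2
  rw [add_assoc]
  congr 1
  rw [Matrix.conjTranspose_mul, Matrix.mul_sub, Matrix.sub_mul, smul_sub]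
  simp only [Matrix.mul_assoc, Matrix.mul_smul, Matrix.smul_mul, Matrix.mul_one, smul_smul,
    Complex.ofReal_mul]
  abel

lemma gdet_mul_left {ρ q : ℝ} (hρ : 0 ≤ ρ) (H : Matrix ι κ ℂ) (U : Matrix l ι ℂ)
    (hU : ∀ i j, ‖U i j‖ ≤ 1) (hq : (Fintype.card ι : ℝ) * Fintype.card l ≤ q) :
    gdet ρ (U * H) ≤ gdet (ρ * q) H := by
  rw [← gdet_conjTranspose, ← gdet_conjTranspose (ρ * q), Matrix.conjTranspose_mul]
  refine gdet_mul_right hρ _ _ (fun i j => ?_) hq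
  rw [Matrix.conjTranspose_apply, norm_star]
  exact hU j i

lemma gdet_mono {ρ ρ' : ℝ} (hρ : 0 ≤ ρ) (h : ρ ≤ ρ') (H : Matrix ι κ ℂ) :
    gdet ρ H ≤ gdet ρ' H := by
  have h2 := posSemidef_smul_real (Matrix.posSemidef_self_mul_conjTranspose H) (sub_nonneg.2 h)
  have h3 : (1 + (ρ : ℂ) • (H * Hᴴ)).PosDef :=
    Matrix.PosDef.one.add_posSemidef
      (posSemidef_smul_real (Matrix.posSemidef_self_mul_conjTranspose _) hρ)
  have h4 := det_re_mono h3 h2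
  unfold gdet
  refine h4.trans (le_of_eq ?_)
  congr 2
  rw [add_assoc, ← add_smul]; simp

lemma gdet_reindex {ι' κ' : Type*} [Fintype ι'] [DecidableEq ι'] [Fintype κ'] (ρ : ℝ)
    (e : ι' ≃ ι) (f : κ' ≃ κ) (H : Matrix ι κ ℂ) :
    gdet ρ (H.submatrix e f) = gdet ρ H := by
  unfold gdet
  rw [Matrix.conjTranspose_submatrix, Matrix.submatrix_mul_equiv,
    ← Matrix.submatrix_one_equiv e]
  rw [← Matrix.det_submatrix_equiv_self e (1 + (ρ : ℂ) • (H * Hᴴ))]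
  rfl

lemma gdet_blocks {ρ : ℝ} (hρ : 0 ≤ ρ) (a : ℂ) (D : Matrix ι κ ℂ) :
    gdet ρ (Matrix.fromBlocks (Matrix.of fun (_ _ : Unit) => a) 0 0 D) =
      (1 + ρ * ‖a‖ ^ 2) * gdet ρ D := by
  unfold gdet
  rw [Matrix.fromBlocks_conjTranspose, Matrix.fromBlocks_multiply, Matrix.fromBlocks_smul,
    ← Matrix.fromBlocks_one, Matrix.fromBlocks_add]
  simp only [Matrix.conjTranspose_zero, Matrix.mul_zero, Matrix.zero_mul, add_zero, zero_add,
    smul_zero]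
  rw [Matrix.det_fromBlocks_zero₂₁, Matrix.det_unique]
  have : ((1 : Matrix Unit Unit ℂ) + (ρ : ℂ) • ((Matrix.of fun (_ _ : Unit) => a) *
      (Matrix.of fun (_ _ : Unit) => a)ᴴ)) default default = ((1 + ρ * ‖a‖ ^ 2 : ℝ) : ℂ) := by
    simp [Matrix.mul_apply, Complex.mul_conj, Complex.normSq_eq_norm_sq]
  rw [this, Complex.re_ofReal_mul]

/-- elimination constant -/
noncomputable def elimQ (ι κ : Type*) [Fintype ι] [Fintype κ] : ℝ :=
  (((Fintype.card ι : ℝ) + 1) * ((Fintype.card ι : ℝ) + 1)) *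
    (((Fintype.card κ : ℝ) + 1) * ((Fintype.card κ : ℝ) + 1))

lemma one_le_elimQ (ι κ : Type*) [Fintype ι] [Fintype κ] : 1 ≤ elimQ ι κ := by
  unfold elimQ
  have h1 : (0:ℝ) ≤ Fintype.card ι := by positivity
  have h2 : (0:ℝ) ≤ Fintype.card κ := by positivity
  have h3 : 1 ≤ ((Fintype.card ι : ℝ) + 1) * ((Fintype.card ι : ℝ) + 1) := by nlinarith
  have h4 : 1 ≤ ((Fintype.card κ : ℝ) + 1) * ((Fintype.card κ : ℝ) + 1) := by nlinarith
  nlinarith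

lemma gdet_sandwich_aux {ρ : ℝ} (hρ : 0 ≤ ρ) (u : ι → ℂ) (v : κ → ℂ) (hu : ∀ i, ‖u i‖ ≤ 1)
    (hv : ∀ i, ‖v i‖ ≤ 1) (X : Matrix (Unit ⊕ ι) (Unit ⊕ κ) ℂ) :
    gdet ρ ((Matrix.fromBlocks 1 0 (Matrix.of fun i (_ : Unit) => u i) 1 :
        Matrix (Unit ⊕ ι) (Unit ⊕ ι) ℂ) * X *
      (Matrix.fromBlocks 1 (Matrix.of fun (_ : Unit) i => v i) 0 1 :
        Matrix (Unit ⊕ κ) (Unit ⊕ κ) ℂ)) ≤ gdet (ρ * elimQ ι κ) X := by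
  have hone : ∀ (i j : ι), ‖(1 : Matrix ι ι ℂ) i j‖ ≤ 1 := by
    intro i j
    rw [Matrix.one_apply]; split_ifs <;> simp
  have hone' : ∀ (i j : κ), ‖(1 : Matrix κ κ ℂ) i j‖ ≤ 1 := by
    intro i j
    rw [Matrix.one_apply]; split_ifs <;> simp
  refine (gdet_mul_right (q := ((Fintype.card κ : ℝ) + 1) * ((Fintype.card κ : ℝ) + 1))
    hρ _ _ ?_ ?_).trans ?_
  · rintro (i | i) (j | j) <;> simp [hv, hone']
  · simp [add_comm]
  refine (gdet_mul_left (q := ((Fintype.card ι : ℝ) + 1) * ((Fintype.card ι : ℝ) + 1))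
    (by positivity) _ _ ?_ ?_).trans ?_
  · rintro (i | i) (j | j) <;> simp [hu, hone]
  · simp [add_comm]
  · refine le_of_eq ?_
    congr 1
    unfold elimQ; ring

lemma gdet_elim {ρ : ℝ} (hρ : 0 ≤ ρ) (a : ℂ) (ha : a ≠ 0) (b : κ → ℂ) (c : ι → ℂ)
    (hb : ∀ i, ‖b i‖ ≤ ‖a‖) (hc : ∀ i, ‖c i‖ ≤ ‖a‖) (D : Matrix ι κ ℂ) :
    gdet ρ (Matrix.fromBlocks (Matrix.of fun (_ _ : Unit) => a) (Matrix.of fun _ j => b j)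
      (Matrix.of fun i _ => c i) (Matrix.of fun i j => D i j + c i * b j / a))
        ≤ (1 + ρ * elimQ ι κ * ‖a‖ ^ 2) * gdet (ρ * elimQ ι κ) D ∧
    (1 + ρ / elimQ ι κ * ‖a‖ ^ 2) * gdet (ρ / elimQ ι κ) D ≤
    gdet ρ (Matrix.fromBlocks (Matrix.of fun (_ _ : Unit) => a) (Matrix.of fun _ j => b j)
      (Matrix.of fun i _ => c i) (Matrix.of fun i j => D i j + c i * b j / a)) := by
  have hQ := one_le_elimQ ι κ
  have hna : 0 < ‖a‖ := norm_pos_iff.2 ha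
  have hb' : ∀ i, ‖b i / a‖ ≤ 1 := fun i => by rw [norm_div, div_le_one hna]; exact hb i
  have hc' : ∀ i, ‖c i / a‖ ≤ 1 := fun i => by rw [norm_div, div_le_one hna]; exact hc i
  constructor
  · rw [← gdet_blocks (by positivity)]
    have := gdet_sandwich_aux hρ (fun i => c i / a) (fun i => b i / a) hc' hb'
      (Matrix.fromBlocks (Matrix.of fun (_ _ : Unit) => a) 0 0 D)
    convert this using 2
    rw [Matrix.fromBlocks_multiply, Matrix.fromBlocks_multiply]
    ext (i | i) (j | j) <;> simp [Matrix.mul_apply] <;> field_simp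
    ring
  · rw [← gdet_blocks (by positivity)]
    have := gdet_sandwich_aux (ρ := ρ / elimQ ι κ) (by positivity)
      (fun i => -(c i / a)) (fun i => -(b i / a))
      (by simpa using hc') (by simpa using hb')
      (Matrix.fromBlocks (Matrix.of fun (_ _ : Unit) => a) (Matrix.of fun _ j => b j)
      (Matrix.of fun i _ => c i) (Matrix.of fun i j => D i j + c i * b j / a))
    rw [div_mul_cancel₀ _ (by positivity)] at this
    convert this using 2
    rw [Matrix.fromBlocks_multiply, Matrix.fromBlocks_multiply]
    ext (i | i) (j | j) <;> simp [Matrix.mul_apply] <;> field_simp <;> ring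

end PartA


section PartB
open scoped ENNReal

/-- assemble a matrix from pivot, row, column and rest -/
def asm {m n : ℕ} (i : Fin (m+1)) (j : Fin (n+1)) (a : ℂ) (b : Fin n → ℂ) (c : Fin m → ℂ)
    (D : Fin m → Fin n → ℂ) : Fin (m+1) → Fin (n+1) → ℂ :=
  i.insertNth (α := fun _ => Fin (n+1) → ℂ) (j.insertNth (α := fun _ => ℂ) a b)
    (fun k => j.insertNth (α := fun _ => ℂ) (c k) (D k))

lemma lintegral_split {n : ℕ} {E : Type} [MeasureSpace E] [SigmaFinite (volume : Measure E)]
    (j : Fin (n+1)) (F : (Fin (n+1) → E) → ℝ≥0∞) (hF : Measurable F) :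
    ∫⁻ x, F x = ∫⁻ a : E, ∫⁻ b : Fin n → E, F (j.insertNth (α := fun _ => E) a b) := by
  have h := (volume_preserving_piFinSuccAbove (fun _ : Fin (n+1) => E) j).symm
  rw [← h.lintegral_comp hF]
  have h2 : Measurable fun p : E × (Fin n → E) =>
      F ((MeasurableEquiv.piFinSuccAbove (fun _ : Fin (n+1) => E) j).symm p) :=
    hF.comp (MeasurableEquiv.measurable _)
  exact lintegral_prod _ h2.aemeasurable

lemma lintegral_split_rows {m n : ℕ} (j : Fin (n+1)) (F : (Fin m → Fin (n+1) → ℂ) → ℝ≥0∞)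
    (hF : Measurable F) :
    ∫⁻ x, F x = ∫⁻ c : Fin m → ℂ, ∫⁻ D : Fin m → Fin n → ℂ,
      F (fun k => j.insertNth (α := fun _ => ℂ) (c k) (D k)) := by
  have h1 : MeasurePreserving (fun (y : Fin m → ℂ × (Fin n → ℂ)) (k : Fin m) =>
      (MeasurableEquiv.piFinSuccAbove (fun _ : Fin (n+1) => ℂ) j).symm (y k)) :=
    volume_preserving_pi (fun _ => (volume_preserving_piFinSuccAbove (fun _ : Fin (n+1) => ℂ) j).symm)
  have h2 := (volume_measurePreserving_arrowProdEquivProdArrow ℂ (Fin n → ℂ) (Fin m)).symm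
  have h3 := h1.comp h2
  rw [← h3.lintegral_comp hF]
  exact lintegral_prod _ (hF.comp h3.measurable).aemeasurable

lemma lintegral_asm {m n : ℕ} (i : Fin (m+1)) (j : Fin (n+1))
    (F : (Fin (m+1) → Fin (n+1) → ℂ) → ℝ≥0∞) (hF : Measurable F) :
    ∫⁻ H, F H = ∫⁻ a : ℂ, ∫⁻ b : Fin n → ℂ, ∫⁻ c : Fin m → ℂ, ∫⁻ D : Fin m → Fin n → ℂ,
      F (asm i j a b c (fun k l => D k l + c k * b l / a)) := by
  have hm : Measurable fun p : (Fin (n+1) → ℂ) × (Fin m → Fin (n+1) → ℂ) =>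
      F (i.insertNth (α := fun _ => Fin (n+1) → ℂ) p.1 p.2) :=
    hF.comp (MeasurableEquiv.piFinSuccAbove (fun _ : Fin (m+1) => Fin (n+1) → ℂ) i).symm.measurable
  rw [lintegral_split i F hF, lintegral_split j _ hm.lintegral_prod_right']
  refine lintegral_congr fun a => lintegral_congr fun b => ?_
  have hm2 := hm.comp (measurable_prodMk_left (x := j.insertNth (α := fun _ => ℂ) a b))
  refine (lintegral_split_rows j _ hm2).trans ?_
  refine lintegral_congr fun c => ?_
  rw [← lintegral_add_right_eq_self _ (fun k l => c k * b l / a)]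
  rfl

/-- index equivalence singling out index `i` -/
def pivEquiv {m : ℕ} (i : Fin (m+1)) : Unit ⊕ Fin m ≃ Fin (m+1) :=
  (Equiv.sumComm _ _).trans ((Equiv.optionEquivSumPUnit (Fin m)).symm.trans (finSuccEquiv' i).symm)

lemma asm_submatrix {m n : ℕ} (i : Fin (m+1)) (j : Fin (n+1)) (a : ℂ) (b : Fin n → ℂ)
    (c : Fin m → ℂ) (D : Fin m → Fin n → ℂ) :
    (Matrix.of (asm i j a b c D)).submatrix (pivEquiv i) (pivEquiv j) =
    Matrix.fromBlocks (Matrix.of fun (_ _ : Unit) => a) (Matrix.of fun _ j => b j)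
      (Matrix.of fun i _ => c i) (Matrix.of D) := by
  ext (k | k) (l | l) <;> simp [asm, pivEquiv]

lemma asm_elim {m n : ℕ} (i : Fin (m+1)) (j : Fin (n+1)) {ρ : ℝ} (hρ : 0 ≤ ρ)
    (a : ℂ) (ha : a ≠ 0) (b : Fin n → ℂ) (c : Fin m → ℂ) (hb : ‖b‖ ≤ ‖a‖) (hc : ‖c‖ ≤ ‖a‖)
    (D : Fin m → Fin n → ℂ) :
    gdet ρ (Matrix.of (asm i j a b c (fun k l => D k l + c k * b l / a)))
        ≤ (1 + ρ * elimQ (Fin m) (Fin n) * ‖a‖ ^ 2) *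
          gdet (ρ * elimQ (Fin m) (Fin n)) (Matrix.of D) ∧
    (1 + ρ / elimQ (Fin m) (Fin n) * ‖a‖ ^ 2) * gdet (ρ / elimQ (Fin m) (Fin n)) (Matrix.of D) ≤
    gdet ρ (Matrix.of (asm i j a b c (fun k l => D k l + c k * b l / a))) := by
  have h := gdet_elim hρ a ha b c (fun i => (norm_le_pi_norm b i).trans hb)
    (fun i => (norm_le_pi_norm c i).trans hc) (Matrix.of D)
  rw [← gdet_reindex ρ (pivEquiv i) (pivEquiv j), asm_submatrix]
  exact h

lemma continuous_gdet {m n : ℕ} (ρ : ℝ) :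
    Continuous fun H : Fin m → Fin n → ℂ => gdet ρ (Matrix.of H) := by
  unfold gdet
  refine Complex.continuous_re.comp (Continuous.matrix_det ?_)
  have h : Continuous fun H : Fin m → Fin n → ℂ => (Matrix.of H : Matrix (Fin m) (Fin n) ℂ) :=
    continuous_id
  have h2 : Continuous fun H : Fin m → Fin n → ℂ => (ρ : ℂ) • ((Matrix.of H : Matrix (Fin m) (Fin n) ℂ)
      * (Matrix.of H : Matrix (Fin m) (Fin n) ℂ).conjTranspose) :=
    Continuous.fun_const_smul (h.matrix_mul h.matrix_conjTranspose) _
  exact continuous_const.add h2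

lemma asm_norms {m n : ℕ} (i : Fin (m+1)) (j : Fin (n+1)) (a : ℂ) (b : Fin n → ℂ)
    (c : Fin m → ℂ) (D : Fin m → Fin n → ℂ) :
    ‖asm i j a b c D‖ = max (max ‖a‖ ‖b‖) (max ‖c‖ ‖D‖) := by
  apply le_antisymm
  · rw [pi_norm_le_iff_of_nonneg (by positivity)]
    intro k
    rw [pi_norm_le_iff_of_nonneg (by positivity)]
    intro l
    refine Fin.succAboveCases i ?_ (fun k' => ?_) k <;> refine Fin.succAboveCases j ?_ (fun l' => ?_) l
    · simp [asm]
    · simp [asm]; left; right; exact norm_le_pi_norm b l'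
    · simp [asm]; right; left; exact norm_le_pi_norm c k'
    · simp [asm]; right; right; exact (norm_le_pi_norm (D k') l').trans (norm_le_pi_norm D k')
  · have key : ∀ k l, ‖asm i j a b c D k l‖ ≤ ‖asm i j a b c D‖ := fun k l =>
      (norm_le_pi_norm (asm i j a b c D k) l).trans (norm_le_pi_norm _ k)
    refine max_le (max_le ?_ ?_) (max_le ?_ ?_)
    · simpa [asm] using key i j
    · rw [pi_norm_le_iff_of_nonneg (by positivity)]
      intro l
      simpa [asm] using key i (j.succAbove l)
    · rw [pi_norm_le_iff_of_nonneg (by positivity)]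
      intro k
      simpa [asm] using key (i.succAbove k) j
    · rw [pi_norm_le_iff_of_nonneg (by positivity)]
      intro k
      rw [pi_norm_le_iff_of_nonneg (by positivity)]
      intro l
      simpa [asm] using key (i.succAbove k) (j.succAbove l)

end PartB


section PartC
open scoped ENNReal

lemma lintegral_radial_lt_top {q κ : ℝ} (hq : -2 < q) (hκ : 0 < κ) :
    ∫⁻ a : ℂ, ENNReal.ofReal (‖a‖ ^ q * Real.exp (-κ * ‖a‖)) < ⊤ := by
  have h := Complex.integral_rpow_mul_exp_neg_mul_rpow (p := 1) le_rfl hq hκ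
  have hpos : 0 < (2 * Real.pi / 1) * κ ^ (-(q + 2) / 1) * Real.Gamma ((q + 2) / 1) := by
    have : 0 < Real.Gamma ((q + 2) / 1) := Real.Gamma_pos_of_pos (by linarith)
    positivity
  rw [← h] at hpos
  have hi : Integrable (fun x : ℂ => ‖x‖ ^ q * Real.exp (-κ * ‖x‖ ^ (1:ℝ))) := by
    by_contra hc
    rw [integral_undef hc] at hpos
    exact lt_irrefl _ hpos
  simp only [Real.rpow_one] at hi
  exact hi.lintegral_lt_top

lemma volume_closedBall_pi (n : ℕ) {r : ℝ} (hr : 0 ≤ r) :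
    volume (Metric.closedBall (0 : Fin n → ℂ) r) =
      ENNReal.ofReal (r ^ (2 * n)) * volume (Metric.ball (0 : Fin n → ℂ) 1) := by
  have h := Measure.addHaar_closedBall (volume : Measure (Fin n → ℂ)) 0 hr
  rw [h]
  congr 3
  simp [Module.finrank_pi_fintype, mul_comm]

lemma exists_max_entry {m n : ℕ} (H : Fin (m+1) → Fin (n+1) → ℂ) : ∃ i j, ‖H‖ ≤ ‖H i j‖ := by
  obtain ⟨p, hp⟩ := Finite.exists_max (fun p : Fin (m+1) × Fin (n+1) => ‖H p.1 p.2‖)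
  refine ⟨p.1, p.2, ?_⟩
  rw [pi_norm_le_iff_of_nonneg (by positivity)]
  intro k
  rw [pi_norm_le_iff_of_nonneg (by positivity)]
  intro l
  exact hp (k, l)

/-- integrand -/
noncomputable def mint {m n : ℕ} (θ κ ρ : ℝ) (H : Fin m → Fin n → ℂ) : ℝ≥0∞ :=
  ENNReal.ofReal (Real.exp (-κ * ‖H‖) * gdet ρ (Matrix.of H) ^ (-θ))

lemma measurable_mint {m n : ℕ} (θ κ ρ : ℝ) :
    Measurable (mint θ κ ρ : (Fin m → Fin n → ℂ) → ℝ≥0∞) := by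
  unfold mint
  have := (continuous_gdet (m := m) (n := n) ρ).measurable
  fun_prop

lemma mint_pointwise {m n : ℕ} {θ κ ρ η : ℝ} (hη : 0 ≤ η) (hηθ : η ≤ θ) (hκ : 0 < κ) (hρ : 0 < ρ)
    (i : Fin (m+1)) (j : Fin (n+1)) (a : ℂ) (ha : a ≠ 0) (b : Fin n → ℂ) (c : Fin m → ℂ)
    (D : Fin m → Fin n → ℂ)
    (hH : ‖asm i j a b c (fun k l => D k l + c k * b l / a)‖ ≤ ‖a‖) :
    mint θ κ ρ (asm i j a b c (fun k l => D k l + c k * b l / a)) ≤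
      ENNReal.ofReal (Real.exp (-(κ/2) * ‖a‖) * (ρ / elimQ (Fin m) (Fin n) * ‖a‖ ^ 2) ^ (-η)) *
      mint θ (κ/4) (ρ / elimQ (Fin m) (Fin n)) D := by
  have hQ := one_le_elimQ (Fin m) (Fin n)
  set Q := elimQ (Fin m) (Fin n) with hQdef
  have hna : 0 < ‖a‖ := norm_pos_iff.2 ha
  have hnorm := asm_norms i j a b c (fun k l => D k l + c k * b l / a)
  rw [hnorm] at hH
  have hHa : ‖asm i j a b c (fun k l => D k l + c k * b l / a)‖ = ‖a‖ := by
    rw [hnorm]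
    exact le_antisymm hH (le_max_of_le_left (le_max_left _ _))
  have hb : ‖b‖ ≤ ‖a‖ := (le_max_right _ _).trans ((le_max_left _ _).trans hH)
  have hc : ‖c‖ ≤ ‖a‖ := (le_max_left _ _).trans ((le_max_right _ _).trans hH)
  have hD' : ‖(fun k l => D k l + c k * b l / a)‖ ≤ ‖a‖ :=
    (le_max_right _ _).trans ((le_max_right _ _).trans hH)
  have hD : ‖D‖ ≤ 2 * ‖a‖ := by
    rw [pi_norm_le_iff_of_nonneg (by positivity)]
    intro k
    rw [pi_norm_le_iff_of_nonneg (by positivity)]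
    intro l
    have h1 : ‖D k l + c k * b l / a‖ ≤ ‖a‖ :=
      ((norm_le_pi_norm (fun l => D k l + c k * b l / a) l).trans
        (norm_le_pi_norm (fun k l => D k l + c k * b l / a) k)).trans hD'
    have h2 : ‖c k * b l / a‖ ≤ ‖a‖ := by
      rw [norm_div, norm_mul, div_le_iff₀ hna]
      exact mul_le_mul ((norm_le_pi_norm c k).trans hc) ((norm_le_pi_norm b l).trans hb)
        (norm_nonneg _) (norm_nonneg _)
    calc ‖D k l‖ = ‖(D k l + c k * b l / a) - c k * b l / a‖ := by ring_nf
      _ ≤ _ := (norm_sub_le _ _).trans (by linarith)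
  have hel := (asm_elim i j hρ.le a ha b c hb hc D).2
  rw [← hQdef] at hel
  have hg' : 1 ≤ gdet (ρ / Q) (Matrix.of D) := one_le_gdet (by positivity) _
  unfold mint
  rw [← ENNReal.ofReal_mul (by positivity)]
  apply ENNReal.ofReal_le_ofReal
  rw [hHa]
  have hx : 0 < ρ / Q * ‖a‖ ^ 2 := by positivity
  have e1 : Real.exp (-κ * ‖a‖) ≤ Real.exp (-(κ/2) * ‖a‖) * Real.exp (-(κ/4) * ‖D‖) := by
    rw [← Real.exp_add]
    apply Real.exp_le_exp.2
    nlinarith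
  have e2 : gdet ρ (Matrix.of (asm i j a b c (fun k l => D k l + c k * b l / a))) ^ (-θ) ≤
      (ρ / Q * ‖a‖ ^ 2) ^ (-η) * gdet (ρ / Q) (Matrix.of D) ^ (-θ) := by
    calc _ ≤ ((1 + ρ / Q * ‖a‖ ^ 2) * gdet (ρ / Q) (Matrix.of D)) ^ (-θ) :=
          Real.rpow_le_rpow_of_nonpos (by positivity) hel (by linarith)
      _ = (1 + ρ / Q * ‖a‖ ^ 2) ^ (-θ) * gdet (ρ / Q) (Matrix.of D) ^ (-θ) :=
          Real.mul_rpow (by positivity) (by positivity)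
      _ ≤ _ := by
        gcongr
        calc (1 + ρ / Q * ‖a‖ ^ 2) ^ (-θ) ≤ (1 + ρ / Q * ‖a‖ ^ 2) ^ (-η) :=
              Real.rpow_le_rpow_of_exponent_le (by linarith) (by linarith)
          _ ≤ _ := Real.rpow_le_rpow_of_nonpos hx (by linarith) (by linarith)
  have hgH : 0 ≤ gdet ρ (Matrix.of (asm i j a b c (fun k l => D k l + c k * b l / a))) :=
    zero_le_one.trans (one_le_gdet hρ.le _)
  calc _ ≤ (Real.exp (-(κ/2) * ‖a‖) * Real.exp (-(κ/4) * ‖D‖)) *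
        ((ρ / Q * ‖a‖ ^ 2) ^ (-η) * gdet (ρ / Q) (Matrix.of D) ^ (-θ)) := by
        exact mul_le_mul e1 e2 (by positivity) (by positivity)
    _ = _ := by ring

lemma mint_pivot {m n : ℕ} {θ κ ρ η : ℝ} (hη : 0 ≤ η) (hηθ : η ≤ θ) (hκ : 0 < κ) (hρ : 0 < ρ)
    (i : Fin (m+1)) (j : Fin (n+1)) :
    ∫⁻ H : Fin (m+1) → Fin (n+1) → ℂ, {H : Fin (m+1) → Fin (n+1) → ℂ | ‖H‖ ≤ ‖H i j‖}.indicator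
      (mint θ κ ρ) H ≤
    (∫⁻ a : ℂ, ENNReal.ofReal (‖a‖ ^ (2 * ((m:ℝ) + n) - 2 * η) * Real.exp (-(κ/2) * ‖a‖))) *
     volume (Metric.ball (0 : Fin n → ℂ) 1) * volume (Metric.ball (0 : Fin m → ℂ) 1) *
     ENNReal.ofReal ((ρ / elimQ (Fin m) (Fin n)) ^ (-η)) *
     ∫⁻ D : Fin m → Fin n → ℂ, mint θ (κ/4) (ρ / elimQ (Fin m) (Fin n)) D := by
  have hQ := one_le_elimQ (Fin m) (Fin n)
  set Q := elimQ (Fin m) (Fin n) with hQdef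
  have hmeas : MeasurableSet {H : Fin (m+1) → Fin (n+1) → ℂ | ‖H‖ ≤ ‖H i j‖} :=
    measurableSet_le (by fun_prop) (by fun_prop)
  set J := ∫⁻ D : Fin m → Fin n → ℂ, mint θ (κ/4) (ρ / Q) D with hJ
  rw [lintegral_asm i j _ ((measurable_mint θ κ ρ).indicator hmeas)]
  have step : ∀ a : ℂ, a ≠ 0 → (∫⁻ b : Fin n → ℂ, ∫⁻ c : Fin m → ℂ, ∫⁻ D : Fin m → Fin n → ℂ,
      {H : Fin (m+1) → Fin (n+1) → ℂ | ‖H‖ ≤ ‖H i j‖}.indicator (mint θ κ ρ)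
        (asm i j a b c (fun k l => D k l + c k * b l / a))) ≤
      ENNReal.ofReal (‖a‖ ^ (2 * ((m:ℝ) + n) - 2 * η) * Real.exp (-(κ/2) * ‖a‖)) *
       (volume (Metric.ball (0 : Fin n → ℂ) 1) * volume (Metric.ball (0 : Fin m → ℂ) 1) *
       ENNReal.ofReal ((ρ / Q) ^ (-η)) * J) := by
    intro a ha
    have hna : 0 < ‖a‖ := norm_pos_iff.2 ha
    set A := ENNReal.ofReal (Real.exp (-(κ/2) * ‖a‖) * (ρ / Q * ‖a‖ ^ 2) ^ (-η)) with hA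
    have hpt : ∀ b c D, {H : Fin (m+1) → Fin (n+1) → ℂ | ‖H‖ ≤ ‖H i j‖}.indicator (mint θ κ ρ)
        (asm i j a b c (fun k l => D k l + c k * b l / a)) ≤
        (Metric.closedBall (0 : Fin n → ℂ) ‖a‖).indicator (fun _ => 1) b *
        ((Metric.closedBall (0 : Fin m → ℂ) ‖a‖).indicator (fun _ => 1) c *
        (A * mint θ (κ/4) (ρ / Q) D)) := by
      intro b c D
      by_cases h : ‖asm i j a b c (fun k l => D k l + c k * b l / a)‖ ≤ ‖a‖
      · have hb : b ∈ Metric.closedBall (0 : Fin n → ℂ) ‖a‖ := by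
          rw [mem_closedBall_zero_iff]
          rw [asm_norms] at h
          exact (le_max_right _ _).trans ((le_max_left _ _).trans h)
        have hc : c ∈ Metric.closedBall (0 : Fin m → ℂ) ‖a‖ := by
          rw [mem_closedBall_zero_iff]
          rw [asm_norms] at h
          exact (le_max_left _ _).trans ((le_max_right _ _).trans h)
        rw [Set.indicator_of_mem hb, Set.indicator_of_mem hc, one_mul, one_mul]
        exact (Set.indicator_le_self _ _ _).trans
          (mint_pointwise hη hηθ hκ hρ i j a ha b c D h)
      · rw [Set.indicator_of_notMem]
        · exact zero_le
        · simpa [asm] using h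
    calc _ ≤ ∫⁻ b : Fin n → ℂ, ∫⁻ c : Fin m → ℂ, ∫⁻ D : Fin m → Fin n → ℂ,
          (Metric.closedBall (0 : Fin n → ℂ) ‖a‖).indicator (fun _ => 1) b *
          ((Metric.closedBall (0 : Fin m → ℂ) ‖a‖).indicator (fun _ => 1) c *
          (A * mint θ (κ/4) (ρ / Q) D)) :=
          lintegral_mono fun b => lintegral_mono fun c => lintegral_mono fun D => hpt b c D
      _ = volume (Metric.closedBall (0 : Fin n → ℂ) ‖a‖) *
          (volume (Metric.closedBall (0 : Fin m → ℂ) ‖a‖) * (A * J)) := by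
          have hm := measurable_mint (m := m) (n := n) θ (κ/4) (ρ/Q)
          have h1 : ∀ b c, ∫⁻ D : Fin m → Fin n → ℂ,
            (Metric.closedBall (0 : Fin n → ℂ) ‖a‖).indicator (fun _ => (1:ℝ≥0∞)) b *
            ((Metric.closedBall (0 : Fin m → ℂ) ‖a‖).indicator (fun _ => 1) c *
            (A * mint θ (κ/4) (ρ / Q) D)) =
            (Metric.closedBall (0 : Fin n → ℂ) ‖a‖).indicator (fun _ => (1:ℝ≥0∞)) b *
            ((Metric.closedBall (0 : Fin m → ℂ) ‖a‖).indicator (fun _ => 1) c * (A * J)) := by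
            intro b c
            rw [lintegral_const_mul _ ((hm.const_mul _).const_mul _),
              lintegral_const_mul _ (hm.const_mul _), lintegral_const_mul _ hm]
          simp_rw [h1]
          have hi : ∀ k : ℕ, Measurable ((Metric.closedBall (0 : Fin k → ℂ) ‖a‖).indicator
              (fun _ => (1:ℝ≥0∞))) := fun k =>
            measurable_const.indicator Metric.isClosed_closedBall.measurableSet
          have hv : ∀ k : ℕ, ∫⁻ b, (Metric.closedBall (0 : Fin k → ℂ) ‖a‖).indicator
              (fun _ => (1:ℝ≥0∞)) b = volume (Metric.closedBall (0 : Fin k → ℂ) ‖a‖) := fun k => by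
            rw [lintegral_indicator Metric.isClosed_closedBall.measurableSet]; simp
          have h2 : ∀ b, ∫⁻ c : Fin m → ℂ,
            (Metric.closedBall (0 : Fin n → ℂ) ‖a‖).indicator (fun _ => (1:ℝ≥0∞)) b *
            ((Metric.closedBall (0 : Fin m → ℂ) ‖a‖).indicator (fun _ => 1) c * (A * J)) =
            (Metric.closedBall (0 : Fin n → ℂ) ‖a‖).indicator (fun _ => (1:ℝ≥0∞)) b *
            (volume (Metric.closedBall (0 : Fin m → ℂ) ‖a‖) * (A * J)) := by
            intro b
            rw [lintegral_const_mul _ ((hi m).mul_const _), lintegral_mul_const _ (hi m), hv]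
          simp_rw [h2]
          rw [lintegral_mul_const _ (hi n), hv]
      _ = _ := by
          rw [volume_closedBall_pi _ hna.le, volume_closedBall_pi _ hna.le, hA]
          have e : ‖a‖ ^ (2 * ((m:ℝ) + n) - 2 * η) * Real.exp (-(κ/2) * ‖a‖) * (ρ / Q) ^ (-η) =
              ‖a‖ ^ (2 * n) * (‖a‖ ^ (2 * m) *
                (Real.exp (-(κ/2) * ‖a‖) * (ρ / Q * ‖a‖ ^ 2) ^ (-η))) := by
            rw [Real.mul_rpow (by positivity) (by positivity), ← Real.rpow_natCast ‖a‖ 2,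
              ← Real.rpow_mul hna.le, ← Real.rpow_natCast, ← Real.rpow_natCast]
            have : ‖a‖ ^ (2 * ((m:ℝ) + n) - 2 * η) = ‖a‖ ^ ((2 * n : ℕ) : ℝ) *
                ‖a‖ ^ ((2 * m : ℕ) : ℝ) * ‖a‖ ^ (((2:ℕ):ℝ) * (-η)) := by
              rw [← Real.rpow_add hna, ← Real.rpow_add hna]
              congr 1
              push_cast; ring
            rw [this]; ring
          have e' := congrArg ENNReal.ofReal e
          rw [ENNReal.ofReal_mul (by positivity),
            ENNReal.ofReal_mul (p := ‖a‖ ^ (2 * n)) (by positivity),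
            ENNReal.ofReal_mul (p := ‖a‖ ^ (2 * m)) (by positivity)] at e'
          calc _ = (ENNReal.ofReal (‖a‖ ^ (2 * n)) * (ENNReal.ofReal (‖a‖ ^ (2 * m)) *
              ENNReal.ofReal (Real.exp (-(κ/2) * ‖a‖) * (ρ / Q * ‖a‖ ^ 2) ^ (-η)))) *
              (volume (Metric.ball (0 : Fin n → ℂ) 1) * volume (Metric.ball (0 : Fin m → ℂ) 1)
                * J) := by ring
            _ = _ := by rw [← e']; ring
  have hae : ∀ᵐ a : ℂ, a ≠ 0 := by
    simp [ae_iff]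
  refine (lintegral_mono_ae (hae.mono step)).trans (le_of_eq ?_)
  rw [lintegral_mul_const _ (by fun_prop)]
  ring

theorem mint_bound (θ : ℝ) (η : ℕ → ℝ) (m : ℕ) : ∀ (n : ℕ) (κ : ℝ), 0 < κ →
    (∀ j < min m n, 0 ≤ η j ∧ η j ≤ θ ∧ η j < 2 * (j:ℝ) + 1 + |(m:ℝ) - n|) →
    ∃ C : ℝ≥0∞, C ≠ ⊤ ∧ ∀ ρ : ℝ, 0 < ρ → ∫⁻ H : Fin m → Fin n → ℂ, mint θ κ ρ H ≤
      C * ENNReal.ofReal (ρ ^ (-∑ j ∈ Finset.range (min m n), η j)) := by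
  have base : ∀ (m n : ℕ), (m = 0 ∨ n = 0) → ∀ κ : ℝ, 
      ∃ C : ℝ≥0∞, C ≠ ⊤ ∧ ∀ ρ : ℝ, 0 < ρ → ∫⁻ H : Fin m → Fin n → ℂ, mint θ κ ρ H ≤
      C * ENNReal.ofReal (ρ ^ (-∑ j ∈ Finset.range (min m n), η j)) := by
    intro m n h κ
    have hmin : min m n = 0 := by omega
    refine ⟨volume (Set.univ : Set (Fin m → Fin n → ℂ)), ?_, ?_⟩
    · have : Finite (Fin m → Fin n → ℂ) := by
        rcases h with rfl | rfl <;> infer_instance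
      exact (Set.finite_univ.isCompact.measure_lt_top).ne
    · intro ρ hρ
      rw [hmin]
      have : ∀ H : Fin m → Fin n → ℂ, mint θ κ ρ H = 1 := by
        intro H
        have h0 : H = 0 := by
          rcases h with rfl | rfl
          · ext i; exact i.elim0
          · ext i j; exact j.elim0
        subst h0
        unfold mint gdet
        have : (Matrix.of (0 : Fin m → Fin n → ℂ)) = 0 := rfl
        rw [this]
        simp
      simp [this]
  induction m with
  | zero => intro n κ _ _; exact base 0 n (Or.inl rfl) κ
  | succ m ih =>
    intro n
    cases n with
    | zero => intro κ _ _; exact base (m+1) 0 (Or.inr rfl) κ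
    | succ n =>
      intro κ hκ hη
      rw [show min (m+1) (n+1) = min m n + 1 by omega] at *
      have habs : |((m+1 : ℕ):ℝ) - ((n+1 : ℕ):ℝ)| = |(m:ℝ) - n| := by push_cast; congr 1; ring
      rw [habs] at hη
      obtain ⟨C, hC, hCb⟩ := ih n (κ/4) (by positivity) (fun j hj => hη j (by omega))
      obtain ⟨hη0, hηθ, hηw⟩ := hη (min m n) (by omega)
      have hw : 2 * ((min m n : ℕ):ℝ) + 1 + |(m:ℝ) - n| = m + n + 1 := by
        push_cast
        rcases le_total (m:ℝ) n with h | h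
        · rw [min_eq_left h, abs_of_nonpos (by linarith)]; ring
        · rw [min_eq_right h, abs_of_nonneg (by linarith)]; ring
      rw [hw] at hηw
      have hQ := one_le_elimQ (Fin m) (Fin n)
      set Q := elimQ (Fin m) (Fin n) with hQdef
      set e := η (min m n) with he
      set S := ∑ j ∈ Finset.range (min m n), η j with hS
      set I := (∫⁻ a : ℂ, ENNReal.ofReal (‖a‖ ^ (2 * ((m:ℝ) + n) - 2 * e) *
        Real.exp (-(κ/2) * ‖a‖))) with hI
      have hIt : I ≠ ⊤ := (lintegral_radial_lt_top (by linarith) (by positivity)).ne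
      set K := I * volume (Metric.ball (0 : Fin n → ℂ) 1) * volume (Metric.ball (0 : Fin m → ℂ) 1)
        with hK
      have hKt : K ≠ ⊤ := ENNReal.mul_ne_top (ENNReal.mul_ne_top hIt measure_ball_lt_top.ne)
        measure_ball_lt_top.ne
      refine ⟨∑ _i : Fin (m+1), ∑ _j : Fin (n+1), K * C * ENNReal.ofReal (Q ^ (e + S)), ?_, ?_⟩
      · exact ENNReal.sum_ne_top.2 fun _ _ => ENNReal.sum_ne_top.2 fun _ _ =>
          ENNReal.mul_ne_top (ENNReal.mul_ne_top hKt hC) ENNReal.ofReal_ne_top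
      · intro ρ hρ
        have hmeas : ∀ i j, MeasurableSet {H : Fin (m+1) → Fin (n+1) → ℂ | ‖H‖ ≤ ‖H i j‖} :=
          fun i j => measurableSet_le (by fun_prop) (by fun_prop)
        calc _ ≤ ∫⁻ H : Fin (m+1) → Fin (n+1) → ℂ, ∑ i, ∑ j,
              {H : Fin (m+1) → Fin (n+1) → ℂ | ‖H‖ ≤ ‖H i j‖}.indicator (mint θ κ ρ) H := by
              refine lintegral_mono fun H => ?_
              obtain ⟨i, j, hij⟩ := exists_max_entry H
              have h1 : mint θ κ ρ H = {H : Fin (m+1) → Fin (n+1) → ℂ | ‖H‖ ≤ ‖H i j‖}.indicator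
                (mint θ κ ρ) H := by rw [Set.indicator_of_mem]; exact hij
              have h2 := Finset.single_le_sum (f := fun j =>
                {H : Fin (m+1) → Fin (n+1) → ℂ | ‖H‖ ≤ ‖H i j‖}.indicator (mint θ κ ρ) H)
                (fun _ _ => zero_le) (Finset.mem_univ j)
              have h3 := Finset.single_le_sum (f := fun i => ∑ j,
                {H : Fin (m+1) → Fin (n+1) → ℂ | ‖H‖ ≤ ‖H i j‖}.indicator (mint θ κ ρ) H)
                (fun _ _ => zero_le) (Finset.mem_univ i)
              rw [h1]
              exact h2.trans h3
          _ = ∑ i, ∑ j, ∫⁻ H : Fin (m+1) → Fin (n+1) → ℂ,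
              {H : Fin (m+1) → Fin (n+1) → ℂ | ‖H‖ ≤ ‖H i j‖}.indicator (mint θ κ ρ) H := by
              rw [lintegral_finsetSum]
              · refine Finset.sum_congr rfl fun i _ => ?_
                rw [lintegral_finsetSum]
                exact fun j _ => (measurable_mint θ κ ρ).indicator (hmeas i j)
              · exact fun i _ => Finset.measurable_fun_sum _ fun j _ =>
                  (measurable_mint θ κ ρ).indicator (hmeas i j)
          _ ≤ ∑ _i : Fin (m+1), ∑ _j : Fin (n+1),
                K * C * ENNReal.ofReal (Q ^ (e + S)) * ENNReal.ofReal (ρ ^ (-(S + e))) := by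
              refine Finset.sum_le_sum fun i _ => Finset.sum_le_sum fun j _ => ?_
              refine (mint_pivot hη0 hηθ hκ hρ i j).trans ?_
              rw [← hQdef, ← hI, ← hK]
              calc _ ≤ K * ENNReal.ofReal ((ρ / Q) ^ (-e)) *
                    (C * ENNReal.ofReal ((ρ / Q) ^ (-S))) := by
                    gcongr
                    exact hCb (ρ / Q) (by positivity)
                _ = K * C * (ENNReal.ofReal ((ρ / Q) ^ (-e)) * ENNReal.ofReal ((ρ / Q) ^ (-S))) := by
                    ring
                _ = K * C * (ENNReal.ofReal (Q ^ (e + S)) * ENNReal.ofReal (ρ ^ (-(S + e)))) := by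
                    congr 1
                    rw [← ENNReal.ofReal_mul (by positivity), ← ENNReal.ofReal_mul (by positivity)]
                    congr 1
                    rw [← Real.rpow_add (by positivity), Real.div_rpow hρ.le (by positivity),
                      div_eq_mul_inv, ← Real.rpow_neg (by positivity), mul_comm]
                    congr 2 <;> ring
                _ = _ := by ring
          _ = _ := by
              rw [Finset.sum_range_succ, ← hS, ← he, Finset.sum_mul]
              simp_rw [Finset.sum_mul]

end PartC


section PartD
open scoped ENNReal

/-- sets of matrices of small determinant -/
def lowSet (m n : ℕ) (R K ρ : ℝ) (t : ℕ → ℝ) : Set (Fin m → Fin n → ℂ) :=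
  {H | ‖H‖ ≤ R ∧ gdet ρ (Matrix.of H) ≤ K * ∏ j ∈ Finset.range (min m n), (1 + ρ * t j ^ 2)}

lemma measurableSet_lowSet (m n : ℕ) (R K ρ : ℝ) (t : ℕ → ℝ) :
    MeasurableSet (lowSet m n R K ρ t) := by
  have h1 : MeasurableSet {H : Fin m → Fin n → ℂ | ‖H‖ ≤ R} :=
    (isClosed_le continuous_norm continuous_const).measurableSet
  have h2 : MeasurableSet {H : Fin m → Fin n → ℂ | gdet ρ (Matrix.of H) ≤
      K * ∏ j ∈ Finset.range (min m n), (1 + ρ * t j ^ 2)} :=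
    (isClosed_le (continuous_gdet ρ) continuous_const).measurableSet
  exact h1.inter h2

lemma lowSet_step {m n : ℕ} {R K ρ : ℝ} (hR : 0 ≤ R) (hK : 1 ≤ K) (hρ : 0 < ρ) {t : ℕ → ℝ}
    (ht : ∀ j, 0 < t j ∧ t j ≤ 1) (a : ℂ) (b : Fin n → ℂ) (c : Fin m → ℂ)
    (D : Fin m → Fin n → ℂ) (ha : a ∈ Metric.closedBall ((3 * t (min m n) / 4 : ℝ) : ℂ) (t (min m n) / 4))
    (hb : b ∈ Metric.closedBall (0 : Fin n → ℂ) (t (min m n) / 2))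
    (hc : c ∈ Metric.closedBall (0 : Fin m → ℂ) (t (min m n) / 2))
    (hD : D ∈ lowSet m n R K (ρ * elimQ (Fin m) (Fin n)) t) :
    asm 0 0 a b c (fun k l => D k l + c k * b l / a) ∈
      lowSet (m+1) (n+1) (R+1) (elimQ (Fin m) (Fin n) ^ (min m n + 1) * K) ρ t := by
  have hQ := one_le_elimQ (Fin m) (Fin n)
  set Q := elimQ (Fin m) (Fin n) with hQdef
  obtain ⟨ht0, ht1⟩ := ht (min m n)
  set s := t (min m n) with hs
  rw [mem_closedBall_iff_norm] at ha
  rw [mem_closedBall_zero_iff] at hb hc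
  have hn34 : ‖((3 * s / 4 : ℝ) : ℂ)‖ = 3 * s / 4 := by
    rw [Complex.norm_real, Real.norm_of_nonneg (by positivity)]
  have ha1 : s / 2 ≤ ‖a‖ := by
    have := norm_sub_norm_le ((3 * s / 4 : ℝ) : ℂ) a
    rw [norm_sub_rev, hn34] at this
    linarith
  have ha2 : ‖a‖ ≤ s := by
    have := norm_sub_norm_le a ((3 * s / 4 : ℝ) : ℂ)
    rw [hn34] at this
    linarith
  have hna : 0 < ‖a‖ := by linarith
  have ha0 : a ≠ 0 := norm_pos_iff.1 hna
  obtain ⟨hDR, hDg⟩ := hD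
  constructor
  · rw [asm_norms]
    refine max_le (max_le (by linarith) (by linarith)) (max_le (by linarith) ?_)
    rw [pi_norm_le_iff_of_nonneg (by positivity)]
    intro k
    rw [pi_norm_le_iff_of_nonneg (by positivity)]
    intro l
    have h2 : ‖c k * b l / a‖ ≤ ‖a‖ := by
      rw [norm_div, norm_mul, div_le_iff₀ hna]
      exact mul_le_mul ((norm_le_pi_norm c k).trans (by linarith))
        ((norm_le_pi_norm b l).trans (by linarith))
        (norm_nonneg _) (norm_nonneg _)
    have h3 : ‖D k l‖ ≤ R := ((norm_le_pi_norm (D k) l).trans (norm_le_pi_norm D k)).trans hDR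
    exact (norm_add_le _ _).trans (by linarith)
  · have hel := (asm_elim 0 0 hρ.le a ha0 b c (by linarith) (by linarith) D).1
    rw [← hQdef] at hel
    refine hel.trans ?_
    rw [show min (m+1) (n+1) = min m n + 1 by omega, Finset.prod_range_succ, ← hs]
    have key : ∀ x : ℝ, 0 ≤ x → 1 + ρ * Q * x ≤ Q * (1 + ρ * x) := fun x hx => by
      nlinarith [mul_nonneg hρ.le hx]
    have h1 : 1 + ρ * Q * ‖a‖ ^ 2 ≤ Q * (1 + ρ * s ^ 2) := by
      refine le_trans ?_ (key _ (by positivity))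
      gcongr
    have h2 : ∏ j ∈ Finset.range (min m n), (1 + ρ * Q * t j ^ 2) ≤
        Q ^ (min m n) * ∏ j ∈ Finset.range (min m n), (1 + ρ * t j ^ 2) := by
      calc _ ≤ ∏ j ∈ Finset.range (min m n), (Q * (1 + ρ * t j ^ 2)) :=
            Finset.prod_le_prod (fun j _ => by positivity) (fun j _ => key _ (by positivity))
        _ = _ := by rw [Finset.prod_mul_distrib]; simp
    have hg0 : 0 ≤ gdet (ρ * Q) (Matrix.of D) :=
      zero_le_one.trans (one_le_gdet (by positivity) _)
    calc _ ≤ (Q * (1 + ρ * s ^ 2)) * (K * (Q ^ (min m n) *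
          ∏ j ∈ Finset.range (min m n), (1 + ρ * t j ^ 2))) := by
          refine mul_le_mul h1 (hDg.trans ?_) hg0 (by positivity)
          gcongr
      _ = _ := by rw [pow_succ]; ring

theorem lowSet_bound (m : ℕ) : ∀ n : ℕ, ∃ (c : ℝ≥0∞) (R K : ℝ), c ≠ 0 ∧ 0 ≤ R ∧ 1 ≤ K ∧
    ∀ ρ : ℝ, 0 < ρ → ∀ t : ℕ → ℝ, (∀ j, 0 < t j ∧ t j ≤ 1) →
    c * ENNReal.ofReal (∏ j ∈ Finset.range (min m n),
      t j ^ (2 * (2 * j + 1 + (max m n - min m n)))) ≤ volume (lowSet m n R K ρ t) := by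
  have base : ∀ (m n : ℕ), (m = 0 ∨ n = 0) → ∃ (c : ℝ≥0∞) (R K : ℝ), c ≠ 0 ∧ 0 ≤ R ∧ 1 ≤ K ∧
    ∀ ρ : ℝ, 0 < ρ → ∀ t : ℕ → ℝ, (∀ j, 0 < t j ∧ t j ≤ 1) →
    c * ENNReal.ofReal (∏ j ∈ Finset.range (min m n),
      t j ^ (2 * (2 * j + 1 + (max m n - min m n)))) ≤ volume (lowSet m n R K ρ t) := by
    intro m n h
    have hmin : min m n = 0 := by omega
    refine ⟨volume (Set.univ : Set (Fin m → Fin n → ℂ)), 0, 1, ?_, le_rfl, le_rfl, ?_⟩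
    · have h1 : 0 < volume (Metric.ball (0 : Fin m → Fin n → ℂ) 1) :=
        Metric.measure_ball_pos _ _ one_pos
      exact (h1.trans_le (measure_mono (Set.subset_univ _))).ne'
    · intro ρ hρ t ht
      have : lowSet m n 0 1 ρ t = Set.univ := by
        ext H
        simp only [Set.mem_univ, iff_true]
        have h0 : H = 0 := by
          rcases h with rfl | rfl
          · ext i; exact i.elim0
          · ext i j; exact j.elim0
        subst h0
        unfold lowSet gdet
        have : (Matrix.of (0 : Fin m → Fin n → ℂ)) = 0 := rfl
        simp [this, hmin]
      rw [this, hmin]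
      simp
  induction m with
  | zero => intro n; exact base 0 n (Or.inl rfl)
  | succ m ih =>
    intro n
    cases n with
    | zero => exact base (m+1) 0 (Or.inr rfl)
    | succ n =>
      obtain ⟨c', R, K, hc', hR, hK, hb⟩ := ih n
      have hQ := one_le_elimQ (Fin m) (Fin n)
      set Q := elimQ (Fin m) (Fin n) with hQdef
      have hv : ∀ k : ℕ, volume (Metric.ball (0 : Fin k → ℂ) 1) ≠ 0 := fun k =>
        (Metric.measure_ball_pos _ _ one_pos).ne'
      have hv1 : volume (Metric.ball (0 : ℂ) 1) ≠ 0 := (Metric.measure_ball_pos _ _ one_pos).ne'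
      refine ⟨volume (Metric.ball (0 : ℂ) 1) * volume (Metric.ball (0 : Fin n → ℂ) 1) *
        volume (Metric.ball (0 : Fin m → ℂ) 1) * ENNReal.ofReal ((1/4)^2 * (1/2)^(2*n) * (1/2)^(2*m))
        * c', R + 1, Q ^ (min m n + 1) * K, ?_, by linarith, ?_, ?_⟩
      · refine mul_ne_zero (mul_ne_zero (mul_ne_zero (mul_ne_zero hv1 (hv n)) (hv m)) ?_) hc'
        exact (ENNReal.ofReal_pos.2 (by positivity)).ne'
      · have : 1 ≤ Q ^ (min m n + 1) := one_le_pow₀ hQ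
        nlinarith
      · intro ρ hρ t ht
        have hbb := hb (ρ * Q) (by positivity) t ht
        obtain ⟨ht0, ht1⟩ := ht (min m n)
        have hlow := fun a b c D => lowSet_step (m := m) (n := n) hR hK hρ ht a b c D
        rw [← hQdef] at hlow
        set s := t (min m n) with hs
        set S' := lowSet m n R K (ρ * Q) t with hS'
        set S := lowSet (m+1) (n+1) (R+1) (Q ^ (min m n + 1) * K) ρ t with hS
        have hSm : MeasurableSet S := measurableSet_lowSet _ _ _ _ _ _
        have hSm' : MeasurableSet S' := measurableSet_lowSet _ _ _ _ _ _
        have hvol : volume (Metric.closedBall ((3 * s / 4 : ℝ) : ℂ) (s/4)) *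
            (volume (Metric.closedBall (0 : Fin n → ℂ) (s/2)) *
            (volume (Metric.closedBall (0 : Fin m → ℂ) (s/2)) * volume S')) ≤ volume S := by
          have hi : ∀ {E : Type} [MeasureSpace E] (A : Set E), MeasurableSet A →
            Measurable (A.indicator (fun _ => (1:ℝ≥0∞))) := fun A hA => measurable_const.indicator hA
          have hvi : ∀ {E : Type} [MeasureSpace E] (A : Set E), MeasurableSet A →
            ∫⁻ x, A.indicator (fun _ => (1:ℝ≥0∞)) x = volume A := fun A hA => by
              rw [lintegral_indicator hA]; simp
          set B0 := Metric.closedBall ((3 * s / 4 : ℝ) : ℂ) (s/4)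
          set B1 := Metric.closedBall (0 : Fin n → ℂ) (s/2)
          set B2 := Metric.closedBall (0 : Fin m → ℂ) (s/2)
          have hB0 : MeasurableSet B0 := Metric.isClosed_closedBall.measurableSet
          have hB1 : MeasurableSet B1 := Metric.isClosed_closedBall.measurableSet
          have hB2 : MeasurableSet B2 := Metric.isClosed_closedBall.measurableSet
          have hF : Measurable (S.indicator (fun _ => (1:ℝ≥0∞))) := hi S hSm
          rw [← hvi S hSm, lintegral_asm 0 0 _ hF]
          calc _ = ∫⁻ a, ∫⁻ b, ∫⁻ c, ∫⁻ D, B0.indicator (fun _ => (1:ℝ≥0∞)) a *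
                (B1.indicator (fun _ => (1:ℝ≥0∞)) b * (B2.indicator (fun _ => (1:ℝ≥0∞)) c *
                S'.indicator (fun _ => (1:ℝ≥0∞)) D)) := by
                have h1 : ∀ a b c, ∫⁻ D, B0.indicator (fun _ => (1:ℝ≥0∞)) a *
                  (B1.indicator (fun _ => (1:ℝ≥0∞)) b * (B2.indicator (fun _ => (1:ℝ≥0∞)) c *
                  S'.indicator (fun _ => (1:ℝ≥0∞)) D)) = B0.indicator (fun _ => (1:ℝ≥0∞)) a *
                  (B1.indicator (fun _ => (1:ℝ≥0∞)) b * (B2.indicator (fun _ => (1:ℝ≥0∞)) c *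
                  volume S')) := by
                  intro a b c
                  have := hi S' hSm'
                  rw [lintegral_const_mul _ (by fun_prop), lintegral_const_mul _ (by fun_prop),
                    lintegral_const_mul _ this, hvi S' hSm']
                simp_rw [h1]
                have h2 : ∀ a b, ∫⁻ c, B0.indicator (fun _ => (1:ℝ≥0∞)) a *
                  (B1.indicator (fun _ => (1:ℝ≥0∞)) b * (B2.indicator (fun _ => (1:ℝ≥0∞)) c *
                  volume S')) = B0.indicator (fun _ => (1:ℝ≥0∞)) a *
                  (B1.indicator (fun _ => (1:ℝ≥0∞)) b * (volume B2 * volume S')) := by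
                  intro a b
                  have := hi B2 hB2
                  rw [lintegral_const_mul _ (by fun_prop), lintegral_const_mul _ (by fun_prop),
                    lintegral_mul_const _ this, hvi B2 hB2]
                simp_rw [h2]
                have h3 : ∀ a, ∫⁻ b, B0.indicator (fun _ => (1:ℝ≥0∞)) a *
                  (B1.indicator (fun _ => (1:ℝ≥0∞)) b * (volume B2 * volume S')) =
                  B0.indicator (fun _ => (1:ℝ≥0∞)) a * (volume B1 * (volume B2 * volume S')) := by
                  intro a
                  have := hi B1 hB1
                  rw [lintegral_const_mul _ (by fun_prop), lintegral_mul_const _ this, hvi B1 hB1]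
                simp_rw [h3]
                rw [lintegral_mul_const _ (hi B0 hB0), hvi B0 hB0]
            _ ≤ _ := by
                refine lintegral_mono fun a => lintegral_mono fun b => lintegral_mono fun c =>
                  lintegral_mono fun D => ?_
                by_cases hA : a ∈ B0
                · by_cases hB : b ∈ B1
                  · by_cases hC : c ∈ B2
                    · by_cases hD : D ∈ S'
                      · simp [hA, hB, hC, hD, hlow a b c D hA hB hC hD]
                      · simp [hD]
                    · simp [hC]
                  · simp [hB]
                · simp [hA]
        refine le_trans ?_ hvol
        have hvc : volume (Metric.closedBall ((3 * s / 4 : ℝ) : ℂ) (s/4)) =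
            ENNReal.ofReal ((s/4)^2) * volume (Metric.ball (0 : ℂ) 1) := by
          have h := Measure.addHaar_closedBall (volume : Measure ℂ) ((3 * s / 4 : ℝ) : ℂ)
            (show 0 ≤ s/4 by positivity)
          rw [h, Complex.finrank_real_complex]
        rw [hvc, volume_closedBall_pi _ (by positivity), volume_closedBall_pi _ (by positivity),
          show min (m+1) (n+1) = min m n + 1 by omega, Finset.prod_range_succ, ← hs,
          show max (m+1) (n+1) - (min m n + 1) = max m n - min m n by omega]
        set PP := ∏ j ∈ Finset.range (min m n), t j ^ (2 * (2 * j + 1 + (max m n - min m n))) with hPP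
        have hPP0 : 0 ≤ PP := Finset.prod_nonneg fun j _ => pow_nonneg (ht j).1.le _
        calc _ = volume (Metric.ball (0 : ℂ) 1) * volume (Metric.ball (0 : Fin n → ℂ) 1) *
              volume (Metric.ball (0 : Fin m → ℂ) 1) *
              (ENNReal.ofReal ((1/4)^2 * (1/2)^(2*n) * (1/2)^(2*m)) *
                ENNReal.ofReal (s ^ (2 * (2 * min m n + 1 + (max m n - min m n))))) *
              (c' * ENNReal.ofReal PP) := by
              rw [ENNReal.ofReal_mul hPP0]; ring
          _ = volume (Metric.ball (0 : ℂ) 1) * volume (Metric.ball (0 : Fin n → ℂ) 1) *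
              volume (Metric.ball (0 : Fin m → ℂ) 1) *
              (ENNReal.ofReal ((s/4)^2) * ENNReal.ofReal ((s/2)^(2*n)) *
                ENNReal.ofReal ((s/2)^(2*m))) * (c' * ENNReal.ofReal PP) := by
              congr 2
              rw [← ENNReal.ofReal_mul (by positivity), ← ENNReal.ofReal_mul (by positivity),
                ← ENNReal.ofReal_mul (by positivity)]
              congr 1
              rw [show 2 * (2 * min m n + 1 + (max m n - min m n)) = 2 + 2 * n + 2 * m by omega,
                pow_add, pow_add, div_pow, div_pow, div_pow, div_pow, div_pow, div_pow]
              ring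
          _ ≤ volume (Metric.ball (0 : ℂ) 1) * volume (Metric.ball (0 : Fin n → ℂ) 1) *
              volume (Metric.ball (0 : Fin m → ℂ) 1) *
              (ENNReal.ofReal ((s/4)^2) * ENNReal.ofReal ((s/2)^(2*n)) *
                ENNReal.ofReal ((s/2)^(2*m))) * volume S' := by gcongr
          _ = _ := by ring

end PartD


section PartE
open scoped ENNReal

/-- assemble a complex matrix out of its real coordinates -/
noncomputable def toMat (m n : ℕ) : (((Fin m × Fin n) × Bool) → ℝ) ≃L[ℝ] (Fin m → Fin n → ℂ) :=
  LinearEquiv.toContinuousLinearEquiv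
  { toFun := fun x j k => ⟨x ((j, k), true), x ((j, k), false)⟩
    map_add' := fun x y => by
      funext j k; apply Complex.ext <;> simp
    map_smul' := fun c x => by
      funext j k; apply Complex.ext <;> simp
    invFun := fun H p => if p.2 then (H p.1.1 p.1.2).re else (H p.1.1 p.1.2).im
    left_inv := fun x => by
      funext p
      rcases p with ⟨⟨j, k⟩, b⟩
      cases b <;> simp
    right_inv := fun H => by
      funext j k; apply Complex.ext <;> simp }

lemma toMat_apply (m n : ℕ) (x : ((Fin m × Fin n) × Bool) → ℝ) (j : Fin m) (k : Fin n) :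
    toMat m n x j k = ⟨x ((j, k), true), x ((j, k), false)⟩ := rfl

lemma norm_toMat_le (m n : ℕ) (x : ((Fin m × Fin n) × Bool) → ℝ) :
    ‖toMat m n x‖ ≤ ∑ p, |x p| := by
  have h0 : 0 ≤ ∑ p, |x p| := Finset.sum_nonneg fun _ _ => abs_nonneg _
  rw [pi_norm_le_iff_of_nonneg h0]
  intro j
  rw [pi_norm_le_iff_of_nonneg h0]
  intro k
  refine (Complex.norm_le_abs_re_add_abs_im _).trans ?_
  rw [toMat_apply]
  have := Finset.sum_le_sum_of_subset_of_nonneg (f := fun p => |x p|)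
    (Finset.subset_univ ({((j, k), true), ((j, k), false)} : Finset ((Fin m × Fin n) × Bool)))
    (fun _ _ _ => abs_nonneg _)
  rwa [Finset.sum_pair (by simp)] at this

lemma abs_le_norm_toMat (m n : ℕ) (x : ((Fin m × Fin n) × Bool) → ℝ) (p) :
    |x p| ≤ ‖toMat m n x‖ := by
  rcases p with ⟨⟨j, k⟩, b⟩
  have h : ‖toMat m n x j k‖ ≤ ‖toMat m n x‖ :=
    (norm_le_pi_norm (toMat m n x j) k).trans (norm_le_pi_norm _ j)
  refine le_trans ?_ h
  cases b
  · exact Complex.abs_im_le_norm (toMat m n x j k)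
  · exact Complex.abs_re_le_norm (toMat m n x j k)

lemma pi_gaussian_eq {J : Type} [Fintype J] :
    Measure.pi (fun _ : J => gaussianReal 0 (1/2)) =
      (volume : Measure (J → ℝ)).withDensity
        (fun x => ENNReal.ofReal (∏ p, gaussianPDFReal 0 (1/2) (x p))) := by
  have hv : (1/2 : NNReal) ≠ 0 := by norm_num
  refine Measure.pi_eq fun s hs => ?_
  have hms : MeasurableSet (Set.univ.pi s) := MeasurableSet.univ_pi hs
  rw [withDensity_apply _ hms]
  have hintg : ∀ i, Integrable ((s i).indicator (gaussianPDFReal 0 (1/2))) :=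
    fun i => (integrable_gaussianPDFReal 0 (1/2)).indicator (hs i)
  have hpt : ∀ x : J → ℝ, (Set.univ.pi s).indicator
      (fun x => ENNReal.ofReal (∏ p, gaussianPDFReal 0 (1/2) (x p))) x =
      ENNReal.ofReal (∏ p, (s p).indicator (gaussianPDFReal 0 (1/2)) (x p)) := by
    intro x
    by_cases hx : x ∈ Set.univ.pi s
    · rw [Set.indicator_of_mem hx]
      congr 1
      refine Finset.prod_congr rfl fun p _ => ?_
      rw [Set.indicator_of_mem (hx p (Set.mem_univ p))]
    · rw [Set.indicator_of_notMem hx]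
      simp only [Set.mem_pi, Set.mem_univ, true_implies, not_forall] at hx
      obtain ⟨p, hp⟩ := hx
      rw [Finset.prod_eq_zero (Finset.mem_univ p) (Set.indicator_of_notMem hp _)]
      simp
  have hnn : ∀ i x, 0 ≤ (s i).indicator (gaussianPDFReal 0 (1/2)) x :=
    fun i x => Set.indicator_nonneg (fun _ _ => gaussianPDFReal_nonneg _ _ _) _
  rw [← lintegral_indicator hms]
  simp_rw [hpt]
  have hI : Integrable (fun x : J → ℝ => ∏ p, (s p).indicator (gaussianPDFReal 0 (1/2)) (x p)) :=
    Integrable.fintype_prod hintg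
  rw [← ofReal_integral_eq_lintegral_ofReal hI
    (Filter.Eventually.of_forall fun x => Finset.prod_nonneg fun p _ => hnn p _),
    integral_fintype_prod_volume_eq_prod (fun p => (s p).indicator (gaussianPDFReal 0 (1/2))),
    ENNReal.ofReal_prod_of_nonneg (fun p _ => integral_nonneg (hnn p))]
  refine Finset.prod_congr rfl fun p _ => ?_
  rw [integral_indicator (hs p), ← gaussianReal_apply_eq_integral 0 hv]

lemma pdf_upper (x : ℝ) : gaussianPDFReal 0 (1/2) x ≤ Real.exp 1 * Real.exp (-|x|) := by
  unfold gaussianPDFReal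
  rw [← Real.exp_add]
  have h1 : (√(2 * Real.pi * ((1/2 : NNReal) : ℝ)))⁻¹ ≤ 1 := by
    apply inv_le_one_of_one_le₀
    rw [Real.one_le_sqrt]
    push_cast
    linarith [Real.pi_gt_three]
  have h2 : Real.exp (-(x - 0) ^ 2 / (2 * ((1/2 : NNReal) : ℝ))) ≤ Real.exp (1 + -|x|) := by
    apply Real.exp_le_exp.2
    push_cast
    have := sq_abs x
    nlinarith [sq_nonneg (|x| - 1), abs_nonneg x]
  calc _ ≤ 1 * Real.exp (1 + -|x|) := mul_le_mul h1 h2 (Real.exp_pos _).le zero_le_one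
    _ = _ := one_mul _

lemma pdf_lower {x R : ℝ} (h : |x| ≤ R) : gaussianPDFReal 0 (1/2) R ≤ gaussianPDFReal 0 (1/2) x := by
  unfold gaussianPDFReal
  refine mul_le_mul_of_nonneg_left (Real.exp_le_exp.2 ?_) (by positivity)
  have : x ^ 2 ≤ R ^ 2 := sq_le_sq' (by linarith [neg_abs_le x]) (le_trans (le_abs_self x) h)
  push_cast
  linarith

/-- the law of a standard complex Gaussian matrix -/
noncomputable def gLaw (m n : ℕ) : Measure (Fin m → Fin n → ℂ) :=
  (Measure.pi (fun _ : (Fin m × Fin n) × Bool => gaussianReal 0 (1/2))).map (toMat m n)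

lemma map_volume_toMat (m n : ℕ) : ∃ k : ℝ≥0∞, k ≠ 0 ∧ k ≠ ⊤ ∧
    Measure.map (toMat m n) volume = k • (volume : Measure (Fin m → Fin n → ℂ)) := by
  have hvol : (volume : Measure (Fin m → Fin n → ℂ)).IsAddHaarMeasure :=
    Measure.pi.isAddHaarMeasure (fun _ : Fin m => (volume : Measure (Fin n → ℂ)))
  have hmp : (Measure.map (toMat m n) volume).IsAddHaarMeasure :=
    (toMat m n).isAddHaarMeasure_map volume
  have h := Measure.isAddLeftInvariant_eq_smul (Measure.map (toMat m n) volume)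
    (volume : Measure (Fin m → Fin n → ℂ))
  refine ⟨_, ?_, ENNReal.coe_ne_top, h⟩
  rw [ENNReal.coe_ne_zero]
  exact (Measure.addHaarScalarFactor_pos_of_isAddHaarMeasure _ _).ne'

lemma gLaw_upper (m n : ℕ) : ∃ C : ℝ≥0∞, C ≠ ⊤ ∧ ∀ f : (Fin m → Fin n → ℂ) → ℝ≥0∞, Measurable f →
    ∫⁻ H, f H ∂(gLaw m n) ≤ C * ∫⁻ H, f H * ENNReal.ofReal (Real.exp (-1 * ‖H‖)) := by
  obtain ⟨k, hk0, hk, hmap⟩ := map_volume_toMat m n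
  set c := Real.exp 1 ^ (Fintype.card ((Fin m × Fin n) × Bool)) with hc
  refine ⟨ENNReal.ofReal c * k, ENNReal.mul_ne_top ENNReal.ofReal_ne_top hk, fun f hf => ?_⟩
  have hT : Measurable (toMat m n) := (toMat m n).continuous.measurable
  have hpm : Measurable (fun x : ((Fin m × Fin n) × Bool) → ℝ =>
      ENNReal.ofReal (∏ p, gaussianPDFReal 0 (1/2) (x p))) := by
    have := measurable_gaussianPDFReal 0 (1/2)
    refine ENNReal.measurable_ofReal.comp ?_
    exact Finset.measurable_prod _ (fun p _ => this.comp (measurable_pi_apply p))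
  have hfm : Measurable fun H : Fin m → Fin n → ℂ => f H * ENNReal.ofReal (Real.exp (-1 * ‖H‖)) :=
    hf.mul (by fun_prop)
  unfold gLaw
  have hwd := lintegral_withDensity_eq_lintegral_mul
    (volume : Measure (((Fin m × Fin n) × Bool) → ℝ)) hpm (hf.comp hT)
  simp only [Function.comp_def] at hwd
  rw [lintegral_map hf hT, pi_gaussian_eq, hwd]
  calc _ ≤ ∫⁻ x, ENNReal.ofReal c * (f (toMat m n x) *
        ENNReal.ofReal (Real.exp (-1 * ‖toMat m n x‖))) := by
        refine lintegral_mono fun x => ?_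
        simp only [Pi.mul_apply]
        rw [mul_comm, mul_left_comm, ← ENNReal.ofReal_mul (by positivity)]
        gcongr
        calc _ ≤ ∏ p, (Real.exp 1 * Real.exp (-|x p|)) :=
              Finset.prod_le_prod (fun p _ => gaussianPDFReal_nonneg _ _ _) (fun p _ => pdf_upper _)
          _ = c * Real.exp (∑ p, -|x p|) := by
              rw [Finset.prod_mul_distrib, Real.exp_sum]; simp [hc]
          _ ≤ _ := by
              have := norm_toMat_le m n x
              gcongr
              rw [Finset.sum_neg_distrib]; linarith
    _ = ENNReal.ofReal c * ∫⁻ H, f H * ENNReal.ofReal (Real.exp (-1 * ‖H‖))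
          ∂(Measure.map (toMat m n) volume) := by
        have hcm := lintegral_const_mul (μ := (volume : Measure (((Fin m × Fin n) × Bool) → ℝ)))
          (ENNReal.ofReal c) (hfm.comp hT)
        simp only [Function.comp_def] at hcm
        rw [hcm, lintegral_map hfm hT]
    _ = _ := by
        rw [hmap, lintegral_smul_measure, smul_eq_mul, mul_assoc]

lemma gLaw_lower (m n : ℕ) (R : ℝ) : ∃ c : ℝ≥0∞, c ≠ 0 ∧ ∀ S : Set (Fin m → Fin n → ℂ),
    MeasurableSet S → (∀ H ∈ S, ‖H‖ ≤ R) → c * volume S ≤ gLaw m n S := by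
  obtain ⟨k, hk0, hk, hmap⟩ := map_volume_toMat m n
  set c := gaussianPDFReal 0 (1/2) R ^ (Fintype.card ((Fin m × Fin n) × Bool)) with hc
  have hp := gaussianPDFReal_pos 0 (1/2) R (by norm_num)
  refine ⟨ENNReal.ofReal c * k, mul_ne_zero (ENNReal.ofReal_pos.2 (pow_pos hp _)).ne' hk0,
    fun S hS hR => ?_⟩
  have hT : Measurable (toMat m n) := (toMat m n).continuous.measurable
  unfold gLaw
  rw [Measure.map_apply hT hS, pi_gaussian_eq, withDensity_apply _ (hT hS)]
  calc _ = ENNReal.ofReal c * (Measure.map (toMat m n) volume) S := by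
        rw [hmap, Measure.smul_apply, smul_eq_mul, mul_assoc]
    _ = ∫⁻ x in (toMat m n ⁻¹' S), ENNReal.ofReal c := by
        rw [Measure.map_apply hT hS, setLIntegral_const]
    _ ≤ _ := by
        refine setLIntegral_mono' (hT hS) fun x hx => ENNReal.ofReal_le_ofReal ?_
        rw [hc, ← Finset.card_univ, ← Finset.prod_const]
        exact Finset.prod_le_prod (fun p _ => hp.le)
          fun p _ => pdf_lower ((abs_le_norm_toMat m n x p).trans (hR _ hx))

instance (m n : ℕ) : IsProbabilityMeasure (gLaw m n) :=
  Measure.isProbabilityMeasure_map (toMat m n).continuous.measurable.aemeasurable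

end PartE


section PartF
open scoped ENNReal

/-- the weights -/
noncomputable def wt (m n : ℕ) (j : ℕ) : ℝ := 2 * (j : ℝ) + 1 + |(m:ℝ) - n|

lemma wt_pos (m n j : ℕ) : 0 < wt m n j := by unfold wt; positivity

lemma wt_mono (m n : ℕ) {j k : ℕ} (h : j ≤ k) : wt m n j ≤ wt m n k := by
  unfold wt
  have : (j : ℝ) ≤ k := by exact_mod_cast h
  linarith

lemma measurable_gdet {m n : ℕ} (ρ : ℝ) :
    Measurable fun H : Fin m → Fin n → ℂ => gdet ρ (Matrix.of H) :=
  (continuous_gdet ρ).measurable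

theorem moment_bound (m n : ℕ) {M θ ε : ℝ} (hM : 0 < M) (hθ : 0 ≤ θ) (hε : 0 < ε) :
    ∃ C : ℝ≥0∞, C ≠ ⊤ ∧ ∀ ρ : ℝ, 1 ≤ ρ →
      ∫⁻ H, ENNReal.ofReal (gdet (ρ / M) (Matrix.of H) ^ (-θ)) ∂(gLaw m n) ≤
        C * ENNReal.ofReal (ρ ^ (-(∑ j ∈ Finset.range (min m n), min (wt m n j) θ) + ε)) := by
  obtain ⟨C₁, hC₁, h₁⟩ := gLaw_upper m n
  set p := min m n with hp
  set δ := ε / (p + 1) with hδ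
  have hδ0 : 0 < δ := by positivity
  set η : ℕ → ℝ := fun j => max 0 (min (wt m n j) θ - δ) with hη
  obtain ⟨C₂, hC₂, h₂⟩ := mint_bound θ η m n 1 one_pos (fun j _ => by
    refine ⟨le_max_left _ _, max_le hθ ?_, max_lt ?_ ?_⟩
    · linarith [min_le_right (wt m n j) θ]
    · exact wt_pos m n j
    · have := min_le_left (wt m n j) θ
      unfold wt at this ⊢
      linarith)
  set S := ∑ j ∈ Finset.range p, η j with hS
  have hSle : ∑ j ∈ Finset.range p, min (wt m n j) θ - ε ≤ S := by
    have h1 : ∑ j ∈ Finset.range p, (min (wt m n j) θ - δ) ≤ S :=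
      Finset.sum_le_sum fun j _ => le_max_right _ _
    rw [Finset.sum_sub_distrib] at h1
    simp only [Finset.sum_const, Finset.card_range, nsmul_eq_mul] at h1
    have : (p : ℝ) * δ ≤ ε := by
      rw [hδ, mul_div_assoc', div_le_iff₀ (by positivity)]
      nlinarith
    linarith
  refine ⟨C₁ * (C₂ * ENNReal.ofReal (M ^ S)), ENNReal.mul_ne_top hC₁
    (ENNReal.mul_ne_top hC₂ ENNReal.ofReal_ne_top), fun ρ hρ => ?_⟩
  have hρ0 : 0 < ρ := by linarith
  have hmeas := measurable_gdet (m := m) (n := n) (ρ / M)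
  refine (h₁ _ (by fun_prop)).trans ?_
  rw [mul_assoc]
  gcongr
  calc _ = ∫⁻ H : Fin m → Fin n → ℂ, mint θ 1 (ρ / M) H := by
        refine lintegral_congr fun H => ?_
        unfold mint
        have : 0 ≤ gdet (ρ / M) (Matrix.of H) :=
          zero_le_one.trans (one_le_gdet (by positivity) _)
        rw [← ENNReal.ofReal_mul (by positivity), mul_comm]
    _ ≤ _ := h₂ (ρ / M) (by positivity)
    _ ≤ _ := by
        rw [mul_assoc]
        gcongr
        rw [← ENNReal.ofReal_mul (by positivity)]
        apply ENNReal.ofReal_le_ofReal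
        rw [Real.div_rpow hρ0.le hM.le, Real.rpow_neg hM.le, div_inv_eq_mul, mul_comm]
        gcongr
        · linarith

theorem lower_bound (m n : ℕ) {M : ℝ} (hM : 1 ≤ M) (α : ℕ → ℝ) (hα : ∀ j, 0 ≤ α j) :
    ∃ (c : ℝ≥0∞) (K : ℝ), c ≠ 0 ∧ 0 < K ∧ ∀ ρ : ℝ, 1 ≤ ρ →
      c * ENNReal.ofReal (ρ ^ (-(∑ j ∈ Finset.range (min m n), wt m n j * α j))) ≤
      gLaw m n {H | gdet (ρ / M) (Matrix.of H) ≤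
        K * ρ ^ (∑ j ∈ Finset.range (min m n), max (1 - α j) 0)} := by
  obtain ⟨c₁, R, K, hc₁, hR, hK, h₁⟩ := lowSet_bound m n
  obtain ⟨c₂, hc₂, h₂⟩ := gLaw_lower m n R
  refine ⟨c₂ * c₁, K * 2 ^ (min m n), mul_ne_zero hc₂ hc₁, by positivity, fun ρ hρ => ?_⟩
  have hρ0 : 0 < ρ := by linarith
  set t : ℕ → ℝ := fun j => ρ ^ (-(α j / 2)) with ht
  have ht' : ∀ j, 0 < t j ∧ t j ≤ 1 := fun j =>
    ⟨Real.rpow_pos_of_pos hρ0 _, Real.rpow_le_one_of_one_le_of_nonpos hρ (by linarith [hα j])⟩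
  have h1 := h₁ ρ hρ0 t ht'
  have h2 := h₂ _ (measurableSet_lowSet m n R K ρ t) (fun H hH => hH.1)
  have hprod : ∏ j ∈ Finset.range (min m n), t j ^ (2 * (2 * j + 1 + (max m n - min m n))) =
      ρ ^ (-(∑ j ∈ Finset.range (min m n), wt m n j * α j)) := by
    rw [← Finset.sum_neg_distrib, Real.rpow_sum_of_pos hρ0]
    refine Finset.prod_congr rfl fun j _ => ?_
    rw [ht]
    simp only
    rw [← Real.rpow_natCast, ← Real.rpow_mul hρ0.le]
    congr 1
    have habs : ((max m n - min m n : ℕ) : ℝ) = |(m:ℝ) - n| := by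
      rcases le_total m n with h | h
      · rw [max_eq_right h, min_eq_left h, Nat.cast_sub h, abs_sub_comm, abs_of_nonneg]
        exact sub_nonneg.2 (by exact_mod_cast h)
      · rw [max_eq_left h, min_eq_right h, Nat.cast_sub h, abs_of_nonneg]
        exact sub_nonneg.2 (by exact_mod_cast h)
    push_cast [habs]
    unfold wt
    ring
  rw [hprod] at h1
  calc _ = c₂ * (c₁ * ENNReal.ofReal (ρ ^ (-(∑ j ∈ Finset.range (min m n), wt m n j * α j)))) := by
        ring
    _ ≤ c₂ * volume (lowSet m n R K ρ t) := by gcongr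
    _ ≤ _ := h2
    _ ≤ _ := by
        refine measure_mono fun H hH => ?_
        have h3 : gdet (ρ / M) (Matrix.of H) ≤ gdet ρ (Matrix.of H) :=
          gdet_mono (by positivity) (div_le_self hρ0.le hM) _
        refine h3.trans (hH.2.trans ?_)
        rw [mul_assoc]
        gcongr
        rw [Real.rpow_sum_of_pos hρ0, ← Finset.card_range (min m n), ← Finset.prod_const,
          Finset.card_range, ← Finset.prod_mul_distrib]
        refine Finset.prod_le_prod (fun j _ => by positivity) fun j _ => ?_
        have e1 : ρ * t j ^ 2 = ρ ^ (1 - α j) := by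
          rw [ht]
          simp only
          rw [← Real.rpow_natCast, ← Real.rpow_mul hρ0.le]
          nth_rewrite 1 [← Real.rpow_one ρ]
          rw [← Real.rpow_add hρ0]
          congr 1
          push_cast
          ring
        have e2 : ρ ^ (1 - α j) ≤ ρ ^ (max (1 - α j) 0) :=
          Real.rpow_le_rpow_of_exponent_le hρ (le_max_left _ _)
        have e3 : 1 ≤ ρ ^ (max (1 - α j) 0) := Real.one_le_rpow hρ (le_max_right _ _)
        linarith

end PartF


section PartG
open scoped ENNReal

/-- two-hop outage condition for normalized capacities `x`, `y` -/
def outage (r L x y : ℝ) : Prop :=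
  ENNReal.ofReal r / ENNReal.ofReal x + ENNReal.ofReal r / ENNReal.ofReal y > ENNReal.ofReal L

lemma outage_anti {r L x y x' y' : ℝ} (hx : x' ≤ x) (hy : y' ≤ y) (h : outage r L x y) :
    outage r L x' y' := by
  unfold outage at *
  refine lt_of_lt_of_le h ?_
  gcongr

lemma ofReal_mul_div {r l c : ℝ} (hr : 0 ≤ r) (hl : 0 < l) :
    ENNReal.ofReal (r * l) / ENNReal.ofReal c = ENNReal.ofReal r / ENNReal.ofReal (c / l) := by
  have h1 : ENNReal.ofReal c = ENNReal.ofReal (c / l) * ENNReal.ofReal l := by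
    rw [← ENNReal.ofReal_mul' hl.le, div_mul_cancel₀ _ hl.ne']
  rw [h1, ENNReal.ofReal_mul hr]
  exact ENNReal.mul_div_mul_right _ _ (ENNReal.ofReal_pos.2 hl).ne' ENNReal.ofReal_ne_top

lemma outage_open {r L s t : ℝ} (hr : 0 < r) (h : outage r L s t) :
    ∃ δ > 0, outage r L (s + δ) (t + δ) := by
  have hr' : ENNReal.ofReal r ≠ 0 := (ENNReal.ofReal_pos.2 hr).ne'
  have ht : ∀ s : ℝ, Filter.Tendsto (fun δ : ℝ => ENNReal.ofReal r / ENNReal.ofReal (s + δ))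
      (nhds 0) (nhds (ENNReal.ofReal r / ENNReal.ofReal s)) := by
    intro s
    refine ENNReal.Tendsto.div tendsto_const_nhds (Or.inl hr') ?_ (Or.inr ENNReal.ofReal_ne_top)
    have : Filter.Tendsto (fun δ : ℝ => s + δ) (nhds 0) (nhds (s + 0)) :=
      (continuous_const.add continuous_id).tendsto 0
    rw [add_zero] at this
    exact (ENNReal.continuous_ofReal.tendsto s).comp this
  have h2 := ((ht s).add (ht t)).eventually (lt_mem_nhds h)
  have h3 : ∀ᶠ δ : ℝ in nhdsWithin 0 (Set.Ioi 0), outage r L (s + δ) (t + δ) :=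
    nhdsWithin_le_nhds h2
  obtain ⟨δ, h4, h5⟩ := (h3.and self_mem_nhdsWithin).exists
  exact ⟨δ, h5, h4⟩

lemma sum_clamp {y : ℝ} (hy : 0 ≤ y) (p : ℕ) :
    ∑ j ∈ Finset.range p, max (min (y - j) 1) 0 = min y p := by
  induction p with
  | zero => simp [hy]
  | succ p ih =>
    rw [Finset.sum_range_succ, ih]
    push_cast
    rcases le_total y p with h | h
    · rw [min_eq_left h, max_eq_right ((min_le_left _ _).trans (by linarith)),
        min_eq_left (by linarith)]
      ring
    · rw [min_eq_right h]
      rcases le_total y (p+1) with h' | h'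
      · rw [min_eq_left h', min_eq_left (by linarith), max_eq_left (by linarith)]; ring
      · rw [min_eq_right h', min_eq_right (by linarith), max_eq_left (by linarith)]

lemma exists_exponent (m n p : ℕ) {s : ℝ} (hs : 0 ≤ s) : ∃ (α : ℕ → ℝ) (θ : ℝ),
    Antitone α ∧ (∀ j, 0 ≤ α j) ∧ ∑ j ∈ Finset.range p, max (1 - α j) 0 = min s p ∧
    0 ≤ θ ∧ θ ≤ wt m n p ∧ ((p:ℝ) ≤ s → θ = 0) ∧
    ∑ j ∈ Finset.range p, wt m n j * α j =
      ∑ j ∈ Finset.range p, min (wt m n j) θ - θ * min s p := by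
  by_cases hps : (p : ℝ) ≤ s
  · refine ⟨fun _ => 0, 0, antitone_const, fun _ => le_rfl, ?_, le_rfl, (wt_pos m n p).le,
      fun _ => rfl, ?_⟩
    · simp [hps]
    · have : ∑ j ∈ Finset.range p, min (wt m n j) 0 = 0 :=
        Finset.sum_eq_zero fun j _ => min_eq_right (wt_pos m n j).le
      rw [this]; simp
  · push Not at hps
    set y : ℝ := p - s with hy
    have hy0 : 0 < y := by linarith
    have hyp : y ≤ p := by linarith
    set α : ℕ → ℝ := fun j => max (min (y - j) 1) 0 with hα
    have hα1 : ∀ j, α j ≤ 1 := fun j => max_le (min_le_right _ _) zero_le_one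
    have hsum : ∑ j ∈ Finset.range p, (1 - α j) = s := by
      rw [Finset.sum_sub_distrib, hα, sum_clamp hy0.le p, min_eq_left hyp]
      simp [hy]
    have hsum' : ∑ j ∈ Finset.range p, max (1 - α j) 0 = s := by
      rw [← hsum]
      exact Finset.sum_congr rfl fun j _ => max_eq_left (by linarith [hα1 j])
    refine ⟨α, wt m n ⌊y⌋₊, ?_, fun j => le_max_right _ _, ?_, (wt_pos _ _ _).le, ?_, ?_, ?_⟩
    · intro i j hij
      have : (i : ℝ) ≤ j := by exact_mod_cast hij
      simp only [hα]
      gcongr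
    · rw [hsum', min_eq_left hps.le]
    · exact wt_mono m n (Nat.floor_le_of_le hyp)
    · intro h; linarith
    · rw [min_eq_left hps.le]
      conv_rhs => rw [← hsum]
      rw [Finset.mul_sum, ← Finset.sum_sub_distrib]
      refine Finset.sum_congr rfl fun j _ => ?_
      rcases lt_trichotomy j ⌊y⌋₊ with h | h | h
      · have h1 : ((j + 1 : ℕ) : ℝ) ≤ y := (Nat.le_floor_iff hy0.le).1 h
        push_cast at h1
        have : α j = 1 := by
          simp only [hα]
          rw [min_eq_right (by linarith), max_eq_left zero_le_one]
        rw [this, min_eq_left (wt_mono m n h.le)]; ring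
      · rw [← h, min_self]; ring
      · have h1 : y < j := (Nat.floor_lt hy0.le).1 h
        have : α j = 0 := by
          simp only [hα]
          exact max_eq_right ((min_le_left _ _).trans (by linarith))
        rw [this, min_eq_right (wt_mono m n h.le)]; ring

theorem cell_bound (m n : ℕ) {M s δ ε : ℝ} (hM : 0 < M) (hs : 0 ≤ s) (hδ : 0 < δ) (hε : 0 < ε) :
    ∃ (α : ℕ → ℝ) (C : ℝ≥0∞), Antitone α ∧ (∀ j, 0 ≤ α j) ∧
      ∑ j ∈ Finset.range (min m n), max (1 - α j) 0 = min s (min m n : ℕ) ∧ C ≠ ⊤ ∧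
      ∀ ρ : ℝ, 1 < ρ → gLaw m n {H | Real.log (gdet (ρ / M) (Matrix.of H)) / Real.log ρ ≤ s + δ ∨
          ((min m n : ℕ) : ℝ) ≤ s} ≤
        C * ENNReal.ofReal (ρ ^ (-(∑ j ∈ Finset.range (min m n), wt m n j * α j) +
          wt m n (min m n) * δ + ε)) := by
  obtain ⟨α, θ, h1, h2, h3, h4, h5, h6, h7⟩ := exists_exponent m n (min m n) hs
  obtain ⟨C, hC, hb⟩ := moment_bound m n hM h4 hε
  refine ⟨α, C, h1, h2, h3, hC, fun ρ hρ => ?_⟩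
  have hρ0 : 0 < ρ := by linarith
  have hl : 0 < Real.log ρ := Real.log_pos hρ
  have hmeas := measurable_gdet (m := m) (n := n) (ρ / M)
  set p := min m n with hp
  set S := {H : Fin m → Fin n → ℂ |
    Real.log (gdet (ρ / M) (Matrix.of H)) / Real.log ρ ≤ s + δ ∨ (p : ℝ) ≤ s} with hS
  have hSm : MeasurableSet S := by
    by_cases hps : (p : ℝ) ≤ s
    · have : S = Set.univ := by ext; simp [hS, hps]
      rw [this]; exact MeasurableSet.univ
    · have : S = {H : Fin m → Fin n → ℂ |
          Real.log (gdet (ρ / M) (Matrix.of H)) / Real.log ρ ≤ s + δ} := by ext; simp [hS, hps]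
      rw [this]
      exact measurableSet_le (by fun_prop) measurable_const
  have key : ∀ H ∈ S, 1 ≤ ρ ^ (θ * (min s p + δ)) * gdet (ρ / M) (Matrix.of H) ^ (-θ) := by
    intro H hH
    by_cases hps : (p : ℝ) ≤ s
    · simp [h6 hps]
    · have hH' : Real.log (gdet (ρ / M) (Matrix.of H)) / Real.log ρ ≤ s + δ := by
        rcases hH with h | h
        · exact h
        · exact absurd h hps
      have hg : 0 < gdet (ρ / M) (Matrix.of H) :=
        zero_lt_one.trans_le (one_le_gdet (by positivity) _)
      push Not at hps
      rw [min_eq_left hps.le]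
      rw [div_le_iff₀ hl] at hH'
      rw [Real.rpow_def_of_pos hρ0, Real.rpow_def_of_pos hg, ← Real.exp_add]
      apply Real.one_le_exp
      nlinarith
  calc gLaw m n S = ∫⁻ H, S.indicator 1 H ∂(gLaw m n) := by
        rw [lintegral_indicator_one hSm]
    _ ≤ ∫⁻ H, ENNReal.ofReal (ρ ^ (θ * (min s p + δ))) *
          ENNReal.ofReal (gdet (ρ / M) (Matrix.of H) ^ (-θ)) ∂(gLaw m n) := by
        refine lintegral_mono fun H => ?_
        by_cases hH : H ∈ S
        · rw [Set.indicator_of_mem hH, ← ENNReal.ofReal_mul (by positivity), Pi.one_apply,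
            ← ENNReal.ofReal_one]
          exact ENNReal.ofReal_le_ofReal (key H hH)
        · simp [hH]
    _ = ENNReal.ofReal (ρ ^ (θ * (min s p + δ))) *
          ∫⁻ H, ENNReal.ofReal (gdet (ρ / M) (Matrix.of H) ^ (-θ)) ∂(gLaw m n) :=
        lintegral_const_mul _ (by fun_prop)
    _ ≤ ENNReal.ofReal (ρ ^ (θ * (min s p + δ))) * (C * ENNReal.ofReal
          (ρ ^ (-(∑ j ∈ Finset.range p, min (wt m n j) θ) + ε))) := by
        gcongr
        exact hb ρ hρ.le
    _ ≤ _ := by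
        rw [mul_left_comm, ← ENNReal.ofReal_mul (by positivity), ← Real.rpow_add hρ0]
        refine mul_le_mul_right (ENNReal.ofReal_le_ofReal
          (Real.rpow_le_rpow_of_exponent_le hρ.le ?_)) _
        rw [h7]
        nlinarith [mul_le_mul_of_nonneg_right h5 hδ.le]

lemma exists_cell {X : ℝ} (hX : 0 ≤ X) (p K : ℕ) (hK : 0 < K) :
    ∃ k : ℕ, k < p * K + 1 ∧ (k : ℝ) / K ≤ X ∧ (X ≤ (k : ℝ) / K + 1 / K ∨ (p : ℝ) ≤ (k : ℝ) / K) := by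
  have hK' : (0 : ℝ) < K := by exact_mod_cast hK
  have hXK : 0 ≤ X * K := by positivity
  rcases le_total (p * K) ⌊X * K⌋₊ with h | h
  · refine ⟨p * K, by omega, ?_, Or.inr ?_⟩
    · have := (Nat.le_floor_iff hXK).1 h
      rw [div_le_iff₀ hK']; exact this
    · push_cast; rw [mul_div_assoc, div_self hK'.ne', mul_one]
  · refine ⟨⌊X * K⌋₊, by omega, ?_, Or.inl ?_⟩
    · rw [div_le_iff₀ hK']; exact Nat.floor_le hXK
    · rw [← add_div, le_div_iff₀ hK']; exact (Nat.lt_floor_add_one _).le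

/-- the two-hop outage event -/
def outSet (m₁ n₁ m₂ n₂ : ℕ) (M₁ M₂ r L ρ : ℝ) :
    Set ((Fin m₁ → Fin n₁ → ℂ) × (Fin m₂ → Fin n₂ → ℂ)) :=
  {z | outage r L (Real.log (gdet (ρ / M₁) (Matrix.of z.1)) / Real.log ρ)
    (Real.log (gdet (ρ / M₂) (Matrix.of z.2)) / Real.log ρ)}

lemma measurableSet_outSet (m₁ n₁ m₂ n₂ : ℕ) (M₁ M₂ r L ρ : ℝ) :
    MeasurableSet (outSet m₁ n₁ m₂ n₂ M₁ M₂ r L ρ) := by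
  have h1 : Measurable fun z : (Fin m₁ → Fin n₁ → ℂ) × (Fin m₂ → Fin n₂ → ℂ) =>
      gdet (ρ / M₁) (Matrix.of z.1) := (measurable_gdet (ρ / M₁)).comp measurable_fst
  have h2 : Measurable fun z : (Fin m₁ → Fin n₁ → ℂ) × (Fin m₂ → Fin n₂ → ℂ) =>
      gdet (ρ / M₂) (Matrix.of z.2) := (measurable_gdet (ρ / M₂)).comp measurable_snd
  unfold outSet outage
  exact measurableSet_lt measurable_const (by fun_prop)

theorem two_upper (m₁ n₁ m₂ n₂ : ℕ) {M₁ M₂ r L D ε : ℝ} (hM₁ : 0 < M₁) (hM₂ : 0 < M₂)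
    (hε : 0 < ε)
    (hD : ∀ α β : ℕ → ℝ, Antitone α → (∀ j, 0 ≤ α j) → Antitone β → (∀ j, 0 ≤ β j) →
      outage r L (∑ j ∈ Finset.range (min m₁ n₁), max (1 - α j) 0)
        (∑ j ∈ Finset.range (min m₂ n₂), max (1 - β j) 0) →
      D ≤ ∑ j ∈ Finset.range (min m₁ n₁), wt m₁ n₁ j * α j +
        ∑ j ∈ Finset.range (min m₂ n₂), wt m₂ n₂ j * β j) :
    ∃ C : ℝ≥0∞, C ≠ ⊤ ∧ ∀ ρ : ℝ, 1 < ρ →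
      ((gLaw m₁ n₁).prod (gLaw m₂ n₂)) (outSet m₁ n₁ m₂ n₂ M₁ M₂ r L ρ) ≤
        C * ENNReal.ofReal (ρ ^ (-D + ε)) := by
  set p₁ := min m₁ n₁ with hp₁
  set p₂ := min m₂ n₂ with hp₂
  set W := wt m₁ n₁ p₁ + wt m₂ n₂ p₂ with hW
  have hW0 : 0 < W := add_pos (wt_pos _ _ _) (wt_pos _ _ _)
  obtain ⟨K, hK⟩ := exists_nat_gt (W / (ε / 2))
  have hK0' : (0 : ℝ) < K := lt_trans (by positivity) hK
  have hK0 : 0 < K := by exact_mod_cast hK0'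
  have hWK : W * (1 / K) ≤ ε / 2 := by
    rw [div_lt_iff₀ (by positivity)] at hK
    rw [mul_one_div, div_le_iff₀ hK0']
    linarith
  have hδ : (0 : ℝ) < 1 / K := by positivity
  choose α C₁ a1 a2 a3 a4 a5 using fun k : ℕ => cell_bound m₁ n₁ hM₁
    (show (0:ℝ) ≤ (k:ℝ) / K by positivity) hδ (show 0 < ε / 4 by positivity)
  choose β C₂ b1 b2 b3 b4 b5 using fun k : ℕ => cell_bound m₂ n₂ hM₂
    (show (0:ℝ) ≤ (k:ℝ) / K by positivity) hδ (show 0 < ε / 4 by positivity)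
  classical
  set F := (Finset.range (p₁ * K + 1) ×ˢ Finset.range (p₂ * K + 1)).filter
    (fun q => outage r L (min ((q.1 : ℝ) / K) p₁) (min ((q.2 : ℝ) / K) p₂)) with hF
  refine ⟨∑ q ∈ F, C₁ q.1 * C₂ q.2, ?_, fun ρ hρ => ?_⟩
  · exact ENNReal.sum_ne_top.2 fun q _ => ENNReal.mul_ne_top (a4 _) (b4 _)
  have hρ0 : 0 < ρ := by linarith
  have hl : 0 < Real.log ρ := Real.log_pos hρ
  set S₁ : ℕ → Set (Fin m₁ → Fin n₁ → ℂ) := fun k => {H |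
    Real.log (gdet (ρ / M₁) (Matrix.of H)) / Real.log ρ ≤ (k : ℝ) / K + 1 / K ∨
          ((min m₁ n₁ : ℕ) : ℝ) ≤ (k : ℝ) / K} with hS₁
  set S₂ : ℕ → Set (Fin m₂ → Fin n₂ → ℂ) := fun k => {H |
    Real.log (gdet (ρ / M₂) (Matrix.of H)) / Real.log ρ ≤ (k : ℝ) / K + 1 / K ∨
          ((min m₂ n₂ : ℕ) : ℝ) ≤ (k : ℝ) / K} with hS₂
  have hsub : outSet m₁ n₁ m₂ n₂ M₁ M₂ r L ρ ⊆ ⋃ q ∈ F, S₁ q.1 ×ˢ S₂ q.2 := by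
    intro z hz
    have hz' : outage r L (Real.log (gdet (ρ / M₁) (Matrix.of z.1)) / Real.log ρ)
      (Real.log (gdet (ρ / M₂) (Matrix.of z.2)) / Real.log ρ) := hz
    have hX : 0 ≤ Real.log (gdet (ρ / M₁) (Matrix.of z.1)) / Real.log ρ :=
      div_nonneg (Real.log_nonneg (one_le_gdet (by positivity) _)) hl.le
    have hY : 0 ≤ Real.log (gdet (ρ / M₂) (Matrix.of z.2)) / Real.log ρ :=
      div_nonneg (Real.log_nonneg (one_le_gdet (by positivity) _)) hl.le
    obtain ⟨k, k1, k2, k3⟩ := exists_cell hX p₁ K hK0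
    obtain ⟨l, l1, l2, l3⟩ := exists_cell hY p₂ K hK0
    simp only [Set.mem_iUnion]
    refine ⟨(k, l), ?_, k3, l3⟩
    rw [hF, Finset.mem_filter, Finset.mem_product, Finset.mem_range, Finset.mem_range]
    exact ⟨⟨k1, l1⟩, outage_anti ((min_le_left _ _).trans k2) ((min_le_left _ _).trans l2) hz'⟩
  refine (measure_mono hsub).trans ((measure_biUnion_finset_le _ _).trans ?_)
  rw [Finset.sum_mul]
  refine Finset.sum_le_sum fun q hq => ?_
  rw [hF, Finset.mem_filter] at hq
  have hDq := hD (α q.1) (β q.2) (a1 _) (a2 _) (b1 _) (b2 _) (by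
    rw [a3, b3]; exact hq.2)
  rw [Measure.prod_prod]
  calc _ ≤ _ := mul_le_mul' (a5 q.1 ρ hρ) (b5 q.2 ρ hρ)
    _ = C₁ q.1 * C₂ q.2 * ENNReal.ofReal (ρ ^ (-(∑ j ∈ Finset.range p₁, wt m₁ n₁ j * α q.1 j) +
          wt m₁ n₁ p₁ * (1 / K) + ε / 4 + (-(∑ j ∈ Finset.range p₂, wt m₂ n₂ j * β q.2 j) +
          wt m₂ n₂ p₂ * (1 / K) + ε / 4))) := by
        rw [mul_mul_mul_comm, ← ENNReal.ofReal_mul (by positivity), ← Real.rpow_add hρ0]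
    _ ≤ _ := by
        refine mul_le_mul_right (ENNReal.ofReal_le_ofReal
          (Real.rpow_le_rpow_of_exponent_le hρ.le ?_)) _
        rw [hW, add_mul] at hWK
        linarith

theorem two_lower (m₁ n₁ m₂ n₂ : ℕ) {M₁ M₂ r L : ℝ} (hM₁ : 1 ≤ M₁) (hM₂ : 1 ≤ M₂) (hr : 0 < r)
    (α β : ℕ → ℝ) (hα : ∀ j, 0 ≤ α j) (hβ : ∀ j, 0 ≤ β j)
    (h : outage r L (∑ j ∈ Finset.range (min m₁ n₁), max (1 - α j) 0)
        (∑ j ∈ Finset.range (min m₂ n₂), max (1 - β j) 0)) :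
    ∃ c : ℝ≥0∞, c ≠ 0 ∧ ∀ᶠ ρ : ℝ in Filter.atTop,
      c * ENNReal.ofReal (ρ ^ (-(∑ j ∈ Finset.range (min m₁ n₁), wt m₁ n₁ j * α j +
        ∑ j ∈ Finset.range (min m₂ n₂), wt m₂ n₂ j * β j))) ≤
      ((gLaw m₁ n₁).prod (gLaw m₂ n₂)) (outSet m₁ n₁ m₂ n₂ M₁ M₂ r L ρ) := by
  obtain ⟨δ, hδ, hout⟩ := outage_open hr h
  obtain ⟨c₁, K₁, hc₁, hK₁, h₁⟩ := lower_bound m₁ n₁ hM₁ α hα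
  obtain ⟨c₂, K₂, hc₂, hK₂, h₂⟩ := lower_bound m₂ n₂ hM₂ β hβ
  refine ⟨c₁ * c₂, mul_ne_zero hc₁ hc₂, ?_⟩
  have hlog := Real.tendsto_log_atTop
  filter_upwards [Filter.eventually_gt_atTop 1, hlog.eventually_ge_atTop (Real.log K₁ / δ),
    hlog.eventually_ge_atTop (Real.log K₂ / δ)] with ρ hρ hl₁ hl₂
  have hρ0 : 0 < ρ := by linarith
  have hl : 0 < Real.log ρ := Real.log_pos hρ
  rw [div_le_iff₀ hδ] at hl₁ hl₂
  have key : ∀ (K M s g : ℝ), 0 < K → 1 ≤ g → Real.log K ≤ Real.log ρ * δ →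
      g ≤ K * ρ ^ s → Real.log g / Real.log ρ ≤ s + δ := by
    intro K M s g hK hg hlK hgK
    rw [div_le_iff₀ hl]
    have := Real.log_le_log (by linarith) hgK
    rw [Real.log_mul hK.ne' (Real.rpow_pos_of_pos hρ0 _).ne', Real.log_rpow hρ0] at this
    nlinarith
  rw [neg_add, Real.rpow_add hρ0, ENNReal.ofReal_mul (by positivity), mul_mul_mul_comm]
  refine (mul_le_mul' (h₁ ρ hρ.le) (h₂ ρ hρ.le)).trans ?_
  rw [← Measure.prod_prod]
  refine measure_mono fun z hz => ?_
  refine outage_anti ?_ ?_ hout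
  · exact key K₁ M₁ _ _ hK₁ (one_le_gdet (by positivity) _) hl₁ hz.1
  · exact key K₂ M₂ _ _ hK₂ (one_le_gdet (by positivity) _) hl₂ hz.2

end PartG

section PartH
open scoped ENNReal

lemma exponent_limit {f : ℝ → ℝ≥0∞} {d : ℝ} (hf : ∀ ρ, f ρ ≠ ⊤)
    (hu : ∀ ε > 0, ∃ C : ℝ≥0∞, C ≠ ⊤ ∧ ∀ᶠ ρ : ℝ in Filter.atTop,
      f ρ ≤ C * ENNReal.ofReal (ρ ^ (-d + ε)))
    (hl : ∀ ε > 0, ∃ c : ℝ≥0∞, c ≠ 0 ∧ ∀ᶠ ρ : ℝ in Filter.atTop,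
      c * ENNReal.ofReal (ρ ^ (-(d + ε))) ≤ f ρ) :
    Filter.Tendsto (fun ρ : ℝ => Real.log (f ρ).toReal / Real.log ρ) Filter.atTop (nhds (-d)) := by
  have hlog := Real.tendsto_log_atTop
  -- real versions
  have hl' : ∀ ε > 0, ∃ c : ℝ, 0 < c ∧ ∀ᶠ ρ : ℝ in Filter.atTop,
      c * ρ ^ (-(d + ε)) ≤ (f ρ).toReal := by
    intro ε hε
    obtain ⟨c, hc, h⟩ := hl ε hε
    have hm0 : min c 1 ≠ 0 := (lt_min (pos_iff_ne_zero.2 hc) one_pos).ne'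
    have hmt : min c 1 ≠ ⊤ := ne_top_of_le_ne_top ENNReal.one_ne_top (min_le_right _ _)
    refine ⟨(min c 1).toReal, ENNReal.toReal_pos hm0 hmt, ?_⟩
    filter_upwards [h, Filter.eventually_gt_atTop 0] with ρ h1 hρ
    have h2 : min c 1 * ENNReal.ofReal (ρ ^ (-(d + ε))) ≤ f ρ :=
      (mul_le_mul_left (min_le_left _ _) _).trans h1
    have h3 := ENNReal.toReal_mono (hf ρ) h2
    rwa [ENNReal.toReal_mul, ENNReal.toReal_ofReal (Real.rpow_nonneg hρ.le _)] at h3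
  have hu' : ∀ ε > 0, ∃ C : ℝ, 0 < C ∧ ∀ᶠ ρ : ℝ in Filter.atTop,
      (f ρ).toReal ≤ C * ρ ^ (-d + ε) := by
    intro ε hε
    obtain ⟨C, hC, h⟩ := hu ε hε
    refine ⟨C.toReal + 1, by positivity, ?_⟩
    filter_upwards [h, Filter.eventually_gt_atTop 0] with ρ h1 hρ
    have h3 := ENNReal.toReal_mono (ENNReal.mul_ne_top hC ENNReal.ofReal_ne_top) h1
    rw [ENNReal.toReal_mul, ENNReal.toReal_ofReal (Real.rpow_nonneg hρ.le _)] at h3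
    have := Real.rpow_nonneg hρ.le (-d + ε)
    nlinarith
  rw [tendsto_order]
  constructor
  · intro a ha
    set ε := (-d - a) / 3 with hε
    have hε0 : 0 < ε := by rw [hε]; linarith
    obtain ⟨c, hc, h⟩ := hl' ε hε0
    filter_upwards [h, Filter.eventually_gt_atTop 1,
      hlog.eventually_ge_atTop (-Real.log c / ε)] with ρ h1 hρ h2
    have hρ0 : 0 < ρ := by linarith
    have hlp : 0 < Real.log ρ := Real.log_pos hρ
    have hp := Real.rpow_pos_of_pos hρ0 (-(d + ε))
    have h3 := Real.log_le_log (mul_pos hc hp) h1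
    rw [Real.log_mul hc.ne' hp.ne', Real.log_rpow hρ0] at h3
    rw [div_le_iff₀ hε0] at h2
    rw [lt_div_iff₀ hlp]
    have : a = -d - 3 * ε := by rw [hε]; ring
    rw [this]
    nlinarith
  · intro a ha
    set ε := (a + d) / 3 with hε
    have hε0 : 0 < ε := by rw [hε]; linarith
    obtain ⟨C, hC, h⟩ := hu' ε hε0
    obtain ⟨c, hc, hlo⟩ := hl' 1 one_pos
    filter_upwards [h, hlo, Filter.eventually_gt_atTop 1,
      hlog.eventually_ge_atTop (Real.log C / ε)] with ρ h1 hlo1 hρ h2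
    have hρ0 : 0 < ρ := by linarith
    have hlp : 0 < Real.log ρ := Real.log_pos hρ
    have hp := Real.rpow_pos_of_pos hρ0 (-d + ε)
    have hpos : 0 < (f ρ).toReal :=
      lt_of_lt_of_le (mul_pos hc (Real.rpow_pos_of_pos hρ0 _)) hlo1
    have h3 := Real.log_le_log hpos h1
    rw [Real.log_mul hC.ne' hp.ne', Real.log_rpow hρ0] at h3
    rw [div_le_iff₀ hε0] at h2
    rw [div_lt_iff₀ hlp]
    have : a = -d + 3 * ε := by rw [hε]; ring
    rw [this]
    nlinarith

lemma wt_comm (m n j : ℕ) : wt m n j = wt n m j := by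
  unfold wt; rw [abs_sub_comm]

lemma dVBL_le (a b c : ℕ) {r L : ℝ} (α β : ℕ → ℝ) (hα : Antitone α) (hα0 : ∀ j, 0 ≤ α j)
    (hβ : Antitone β) (hβ0 : ∀ j, 0 ≤ β j)
    (h : outage r L (∑ j ∈ Finset.range (min b a), max (1 - α j) 0)
        (∑ j ∈ Finset.range (min c b), max (1 - β j) 0)) :
    dVBL a b c r L ≤ ∑ j ∈ Finset.range (min b a), wt b a j * α j +
        ∑ j ∈ Finset.range (min c b), wt c b j * β j := by
  rw [min_comm b a, min_comm c b] at *
  unfold dVBL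
  refine csInf_le ⟨0, ?_⟩ ?_
  · rintro x ⟨α, β, h1, h2, h3, h4, h5, rfl⟩
    refine add_nonneg (Finset.sum_nonneg fun j _ => mul_nonneg (by positivity) (h2 j))
      (Finset.sum_nonneg fun j _ => mul_nonneg (by positivity) (h4 j))
  · refine ⟨fun j => α j, fun j => β j, fun j k hjk => hα hjk, fun j => hα0 _,
      fun j k hjk => hβ hjk, fun j => hβ0 _, ?_, ?_⟩
    · unfold outage at h
      rw [Finset.sum_range, Finset.sum_range] at h
      exact h
    · rw [Finset.sum_range, Finset.sum_range]
      congr 1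
      · exact Finset.sum_congr rfl fun j _ => by rw [wt_comm]; rfl
      · exact Finset.sum_congr rfl fun j _ => by rw [wt_comm]; rfl

lemma dVBL_approx (a b c : ℕ) {r L ε : ℝ} (hr : 0 < r) (hε : 0 < ε) :
    ∃ α β : ℕ → ℝ, (∀ j, 0 ≤ α j) ∧ (∀ j, 0 ≤ β j) ∧
      outage r L (∑ j ∈ Finset.range (min b a), max (1 - α j) 0)
        (∑ j ∈ Finset.range (min c b), max (1 - β j) 0) ∧
      ∑ j ∈ Finset.range (min b a), wt b a j * α j +
        ∑ j ∈ Finset.range (min c b), wt c b j * β j ≤ dVBL a b c r L + ε := by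
  have hlt : dVBL a b c r L < dVBL a b c r L + ε := by linarith
  unfold dVBL at hlt
  obtain ⟨x, ⟨α, β, h1, h2, h3, h4, h5, rfl⟩, hx⟩ := exists_lt_of_csInf_lt (by
    refine ⟨_, fun _ => 1, fun _ => 1, fun _ _ _ => le_rfl, fun _ => zero_le_one,
      fun _ _ _ => le_rfl, fun _ => zero_le_one, ?_, rfl⟩
    have hr' : ENNReal.ofReal r ≠ 0 := (ENNReal.ofReal_pos.2 hr).ne'
    simp [ENNReal.div_zero hr']) hlt
  rw [min_comm b a, min_comm c b]
  have hA : ∀ j : Fin (min a b),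
      (if h : (j : ℕ) < min a b then α ⟨j, h⟩ else 0) = α j := fun j => dif_pos j.2
  have hB : ∀ j : Fin (min b c),
      (if h : (j : ℕ) < min b c then β ⟨j, h⟩ else 0) = β j := fun j => dif_pos j.2
  refine ⟨fun j => if h : j < min a b then α ⟨j, h⟩ else 0,
    fun j => if h : j < min b c then β ⟨j, h⟩ else 0, fun j => ?_, fun j => ?_, ?_, ?_⟩
  · simp only; split_ifs
    · exact h2 _
    · exact le_rfl
  · simp only; split_ifs
    · exact h4 _
    · exact le_rfl
  · unfold outage
    rw [Finset.sum_range, Finset.sum_range]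
    simp only [hA, hB]
    exact h5
  · refine le_trans (le_of_eq ?_) hx.le
    rw [Finset.sum_range, Finset.sum_range]
    congr 1
    · exact Finset.sum_congr rfl fun j _ => by rw [wt_comm]; simp only [hA]; rfl
    · exact Finset.sum_congr rfl fun j _ => by rw [wt_comm]; simp only [hB]; rfl

lemma map_pi_pair {J J₁ J₂ : Type} [Fintype J] [Fintype J₁] [Fintype J₂]
    (γ : Measure ℝ) [IsProbabilityMeasure γ] (f₁ : J₁ → J) (f₂ : J₂ → J)
    (h₁ : Function.Injective f₁) (h₂ : Function.Injective f₂) (h : ∀ x y, f₁ x ≠ f₂ y) :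
    Measure.map (fun x : J → ℝ => ((fun j => x (f₁ j) : J₁ → ℝ), (fun j => x (f₂ j) : J₂ → ℝ)))
      (Measure.pi fun _ => γ) = (Measure.pi fun _ => γ).prod (Measure.pi fun _ => γ) := by
  set g : J₁ ⊕ J₂ → J := Sum.elim f₁ f₂ with hg
  have hginj : Function.Injective g := h₁.sumElim h₂ h
  have hind : iIndepFun (fun (j : J) (x : J → ℝ) => x j) (Measure.pi fun _ : J => γ) :=
    iIndepFun_pi (X := fun _ : J => (id : ℝ → ℝ)) (fun _ => aemeasurable_id)
  have hmap := (hind.precomp hginj).map_fun_eq_pi_map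
    (fun i => (measurable_pi_apply (g i)).aemeasurable)
  have hev : ∀ i : J, Measure.map (fun x : J → ℝ => x i) (Measure.pi fun _ : J => γ) = γ :=
    fun i => (measurePreserving_eval (fun _ : J => γ) i).map_eq
  simp only [hev] at hmap
  have hs := (measurePreserving_sumPiEquivProdPi (fun _ : J₁ ⊕ J₂ => γ)).map_eq
  have hgm : Measurable (fun (x : J → ℝ) (i : J₁ ⊕ J₂) => x (g i)) :=
    measurable_pi_lambda _ fun i => measurable_pi_apply _
  rw [← hs, ← hmap]
  exact (Measure.map_map (MeasurableEquiv.sumPiEquivProdPi fun _ : J₁ ⊕ J₂ => ℝ).measurable hgm).symm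

theorem pair_upper (a b c : ℕ) (ha : 0 < a) (hb : 0 < b) {r L ε : ℝ} (hε : 0 < ε) :
    ∃ C : ℝ≥0∞, C ≠ ⊤ ∧ ∀ ρ : ℝ, 1 < ρ →
      ((gLaw b a).prod (gLaw c b)) (outSet b a c b a b r L ρ) ≤
        C * ENNReal.ofReal (ρ ^ (-dVBL a b c r L + ε)) :=
  two_upper b a c b (by exact_mod_cast ha) (by exact_mod_cast hb) hε
    (fun α β h1 h2 h3 h4 h5 => dVBL_le a b c α β h1 h2 h3 h4 h5)

theorem pair_lower (a b c : ℕ) (ha : 0 < a) (hb : 0 < b) {r L ε : ℝ} (hr : 0 < r) (hε : 0 < ε) :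
    ∃ C : ℝ≥0∞, C ≠ 0 ∧ ∀ᶠ ρ : ℝ in Filter.atTop,
      C * ENNReal.ofReal (ρ ^ (-(dVBL a b c r L + ε))) ≤
      ((gLaw b a).prod (gLaw c b)) (outSet b a c b a b r L ρ) := by
  obtain ⟨α, β, h1, h2, h3, h4⟩ := dVBL_approx a b c (L := L) hr hε
  obtain ⟨C, hC, h⟩ := two_lower b a c b (M₁ := a) (M₂ := b) (by exact_mod_cast ha)
    (by exact_mod_cast hb) hr α β h1 h2 h3
  refine ⟨C, hC, ?_⟩
  filter_upwards [h, Filter.eventually_gt_atTop 1] with ρ h5 hρ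
  refine le_trans (mul_le_mul_right (ENNReal.ofReal_le_ofReal
    (Real.rpow_le_rpow_of_exponent_le hρ.le ?_)) _) h5
  linarith

end PartH

/-- **Theorem 7** (DMDT of the VBL ARQ protocol for an `N`-node MIMO multihop network,
long-term static channel): the outage probability of the rate-splitting VBL ARQ scheme,
`P(∃ i ≤ N-2, r log ρ / C_i(ρ) + r log ρ / C_{i+1}(ρ) > L)`, has SNR exponent
`- min_{i} d_VBL^{(M_i, M_{i+1}, M_{i+2})}(r, L)`.  Nodes are zero-indexed: node `i` has
`M i` antennas for `i = 0, ..., N-1`, and `H i` is the channel matrix of hop `i`. -/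
theorem VBL_DMDT_NNode_longTerm
    {Ω : Type*} [MeasurableSpace Ω] (P : Measure Ω) [IsProbabilityMeasure P]
    (N : ℕ) (hN : 3 ≤ N) (M : ℕ → ℕ) (hM : ∀ i < N, 0 < M i)
    (L : ℝ) (hL : 0 < L) (r : ℝ) (hr : 0 < r)
    (H : (i : ℕ) → Ω → Matrix (Fin (M (i+1))) (Fin (M i)) ℂ)
    (hGauss : Measure.map
      (fun ω (p : (Σ i : Fin (N-1), Fin (M (i.val+1)) × Fin (M i.val)) × Bool) =>
        if p.2 then (H p.1.1.val ω p.1.2.1 p.1.2.2).re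
        else (H p.1.1.val ω p.1.2.1 p.1.2.2).im) P
      = Measure.pi (fun _ => gaussianReal 0 (1/2))) :
    Filter.Tendsto (fun ρ : ℝ =>
        Real.log ((P {ω | ∃ i < N - 2,
            ENNReal.ofReal (r * Real.log ρ) / ENNReal.ofReal (cap (M i) ρ (H i ω))
            + ENNReal.ofReal (r * Real.log ρ) / ENNReal.ofReal (cap (M (i+1)) ρ (H (i+1) ω))
            > ENNReal.ofReal L}).toReal)
          / Real.log ρ)
      Filter.atTop
      (nhds (-(sInf {x : ℝ | ∃ i < N - 2,
          x = dVBL (M i) (M (i+1)) (M (i+2)) r L}))) := by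
  classical
  set E : ℕ → ℝ → Set Ω := fun i ρ => {ω |
    ENNReal.ofReal (r * Real.log ρ) / ENNReal.ofReal (cap (M i) ρ (H i ω))
      + ENNReal.ofReal (r * Real.log ρ) / ENNReal.ofReal (cap (M (i+1)) ρ (H (i+1) ω))
      > ENNReal.ofReal L} with hE
  set T : Ω → ((Σ i : Fin (N-1), Fin (M (i.val+1)) × Fin (M i.val)) × Bool) → ℝ :=
    fun ω p => if p.2 then (H p.1.1.val ω p.1.2.1 p.1.2.2).re
        else (H p.1.1.val ω p.1.2.1 p.1.2.2).im with hT
  have hTm : AEMeasurable T P := by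
    by_contra hc
    rw [Measure.map_of_not_aemeasurable hc] at hGauss
    exact IsProbabilityMeasure.ne_zero
      (Measure.pi fun _ : (Σ i : Fin (N-1), Fin (M (i.val+1)) × Fin (M i.val)) × Bool =>
        gaussianReal 0 (1/2)) hGauss.symm
  have hPE : ∀ i < N - 2, ∀ ρ : ℝ, 1 < ρ → P (E i ρ) =
      ((gLaw (M (i+1)) (M i)).prod (gLaw (M (i+2)) (M (i+1))))
        (outSet (M (i+1)) (M i) (M (i+2)) (M (i+1)) (M i) (M (i+1)) r L ρ) := by
    intro i hi ρ hρ
    have hlp : 0 < Real.log ρ := Real.log_pos hρ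
    set f₁ : (Fin (M (i+1)) × Fin (M i)) × Bool →
        (Σ i : Fin (N-1), Fin (M (i.val+1)) × Fin (M i.val)) × Bool :=
      fun q => (⟨⟨i, by omega⟩, q.1⟩, q.2) with hf₁
    set f₂ : (Fin (M (i+2)) × Fin (M (i+1))) × Bool →
        (Σ i : Fin (N-1), Fin (M (i.val+1)) × Fin (M i.val)) × Bool :=
      fun q => (⟨⟨i+1, by omega⟩, q.1⟩, q.2) with hf₂
    have hi₁ : Function.Injective f₁ := by
      rintro ⟨q, b⟩ ⟨q', b'⟩ h
      simp only [hf₁, Prod.mk.injEq, Sigma.mk.injEq, heq_eq_eq, true_and] at h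
      rw [h.1, h.2]
    have hi₂ : Function.Injective f₂ := by
      rintro ⟨q, b⟩ ⟨q', b'⟩ h
      simp only [hf₂, Prod.mk.injEq, Sigma.mk.injEq, heq_eq_eq, true_and] at h
      rw [h.1, h.2]
    have hdis : ∀ x y, f₁ x ≠ f₂ y := by
      intro x y h
      have h1 := congrArg (fun z => z.1.1.val) h
      simp only [hf₁, hf₂] at h1
      omega
    have hmap := map_pi_pair (gaussianReal 0 (1/2)) f₁ f₂ hi₁ hi₂ hdis
    set Sel : (((Σ i : Fin (N-1), Fin (M (i.val+1)) × Fin (M i.val)) × Bool) → ℝ) →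
        (((Fin (M (i+1)) × Fin (M i)) × Bool) → ℝ) ×
        (((Fin (M (i+2)) × Fin (M (i+1))) × Bool) → ℝ) :=
      fun x => ((fun j => x (f₁ j)), (fun j => x (f₂ j))) with hSel
    have hSelm : Measurable Sel :=
      (measurable_pi_lambda _ fun j => measurable_pi_apply _).prodMk
        (measurable_pi_lambda _ fun j => measurable_pi_apply _)
    have hM1 : Measurable (toMat (M (i+1)) (M i)) := (toMat _ _).continuous.measurable
    have hM2 : Measurable (toMat (M (i+2)) (M (i+1))) := (toMat _ _).continuous.measurable
    have hOS := measurableSet_outSet (M (i+1)) (M i) (M (i+2)) (M (i+1)) (M i) (M (i+1)) r L ρ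
    set OS := outSet (M (i+1)) (M i) (M (i+2)) (M (i+1)) (M i) (M (i+1)) r L ρ with hOSdef
    have hset : E i ρ = T ⁻¹' (Sel ⁻¹' (Prod.map (toMat (M (i+1)) (M i))
        (toMat (M (i+2)) (M (i+1))) ⁻¹' OS)) := by
      ext ω
      have e1 : toMat (M (i+1)) (M i) (Sel (T ω)).1 = H i ω := by
        funext j k
        apply Complex.ext <;> simp [toMat_apply, hSel, hT, hf₁]
      have e2 : toMat (M (i+2)) (M (i+1)) (Sel (T ω)).2 = H (i+1) ω := by
        funext j k
        apply Complex.ext <;> simp [toMat_apply, hSel, hT, hf₂]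
      have e3 : Prod.map (toMat (M (i+1)) (M i)) (toMat (M (i+2)) (M (i+1))) (Sel (T ω)) =
          (H i ω, H (i+1) ω) := Prod.ext e1 e2
      rw [Set.mem_preimage, Set.mem_preimage, Set.mem_preimage, e3, hE, Set.mem_setOf_eq,
        ofReal_mul_div hr.le hlp, ofReal_mul_div hr.le hlp]
      rfl
    rw [hset, ← Measure.map_apply_of_aemeasurable hTm (hSelm (hM1.prodMap hM2 hOS)), hGauss,
      ← Measure.map_apply hSelm (hM1.prodMap hM2 hOS), hmap,
      ← Measure.map_apply (hM1.prodMap hM2) hOS, gLaw, gLaw,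
      Measure.map_prod_map _ _ hM1 hM2]
  set D := {x : ℝ | ∃ i < N - 2, x = dVBL (M i) (M (i+1)) (M (i+2)) r L} with hD
  have hDfin : D.Finite := by
    have : D = (fun i => dVBL (M i) (M (i+1)) (M (i+2)) r L) '' (Set.Iio (N-2)) := by
      ext x
      constructor
      · rintro ⟨i, hi, rfl⟩; exact ⟨i, hi, rfl⟩
      · rintro ⟨i, hi, rfl⟩; exact ⟨i, hi, rfl⟩
    rw [this]
    exact (Set.finite_Iio _).image _
  have hDne : D.Nonempty := ⟨_, 0, by omega, rfl⟩
  obtain ⟨i₀, hi₀, hmin⟩ : sInf D ∈ D := hDne.csInf_mem hDfin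
  refine exponent_limit (f := fun ρ => P {ω | ∃ i < N - 2, ω ∈ E i ρ}) (fun ρ => measure_ne_top _ _)
    ?_ ?_
  · intro ε hε
    have hex : ∀ i, ∃ C : ENNReal, C ≠ ⊤ ∧ (i < N - 2 → ∀ ρ : ℝ, 1 < ρ →
        P (E i ρ) ≤ C * ENNReal.ofReal (ρ ^ (-sInf D + ε))) := by
      intro i
      by_cases hi : i < N - 2
      · obtain ⟨C, hC, h⟩ := pair_upper (M i) (M (i+1)) (M (i+2)) (hM i (by omega))
          (hM (i+1) (by omega)) (r := r) (L := L) hε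
        refine ⟨C, hC, fun _ ρ hρ => ?_⟩
        rw [hPE i hi ρ hρ]
        refine (h ρ hρ).trans (mul_le_mul_right (ENNReal.ofReal_le_ofReal
          (Real.rpow_le_rpow_of_exponent_le hρ.le ?_)) _)
        have : sInf D ≤ dVBL (M i) (M (i+1)) (M (i+2)) r L :=
          csInf_le hDfin.bddBelow ⟨i, hi, rfl⟩
        linarith
      · exact ⟨0, ENNReal.zero_ne_top, fun h => absurd h hi⟩
    choose C hC h using hex
    refine ⟨∑ i ∈ Finset.range (N-2), C i, ENNReal.sum_ne_top.2 fun i _ => hC i, ?_⟩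
    filter_upwards [Filter.eventually_gt_atTop 1] with ρ hρ
    have hsub : {ω | ∃ i < N - 2, ω ∈ E i ρ} ⊆ ⋃ i ∈ Finset.range (N-2), E i ρ := by
      rintro ω ⟨i, hi, hω⟩
      simp only [Set.mem_iUnion]
      exact ⟨i, Finset.mem_range.2 hi, hω⟩
    refine (measure_mono hsub).trans ((measure_biUnion_finset_le _ _).trans ?_)
    rw [Finset.sum_mul]
    exact Finset.sum_le_sum fun i hi => h i (Finset.mem_range.1 hi) ρ hρ
  · intro ε hε
    obtain ⟨c, hc, h⟩ := pair_lower (M i₀) (M (i₀+1)) (M (i₀+2)) (hM i₀ (by omega))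
      (hM (i₀+1) (by omega)) (r := r) (L := L) hr hε
    refine ⟨c, hc, ?_⟩
    filter_upwards [h, Filter.eventually_gt_atTop 1] with ρ h1 hρ
    rw [hmin]
    refine h1.trans ?_
    rw [← hPE i₀ hi₀ ρ hρ]
    exact measure_mono fun ω hω => ⟨i₀, hi₀, hω⟩
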